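/- arXiv:2204.04171 — 2 statements merged into one kernel-verified Lean document; each statement's English description precedes it below -/
import Mathlib

section
/- Let 1 < p < ∞ and let W₀ : M^{3×2} → [0,+∞] be continuous as an extended-valued function and p-coercive, with W₀(A) = +∞ if and only if A¹ ∧ A² = 0, and such that for every δ > 0 there exists c_δ > 0 with W₀(A) ≤ c_δ(1 + |A|^p) whenever |A¹ ∧ A²| ≥ δ. Then the quasiconvex envelope QW₀ is finite valued, continuous, p-coercive and rank-one convex. -/
open Filter MeasureTheory Set
open scoped ENNReal

noncomputable section

/-- `v` is piecewise affine on `U`: continuous on `U` and affine on each element of a finite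
family of pairwise disjoint open subsets of `U` covering `U` up to a Lebesgue-null set. -/
def PiecewiseAffineOn {E F : Type*} [NormedAddCommGroup E] [NormedSpace ℝ E]
    [MeasureSpace E] [NormedAddCommGroup F] [NormedSpace ℝ F]
    (v : E → F) (U : Set E) : Prop :=
  ContinuousOn v U ∧
  ∃ (N : ℕ) (V : Fin N → Set E),
    (∀ i, IsOpen (V i)) ∧ (∀ i, V i ⊆ U) ∧
    (∀ i j, i ≠ j → Disjoint (V i) (V j)) ∧
    volume (U \ ⋃ i, V i) = 0 ∧
    ∀ i, ∃ (L : E →L[ℝ] F) (c : F), ∀ x ∈ V i, v x = L x + c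

/-- The Clarke subdifferential of `f` at `x`: the convex hull of all limits of derivatives
`fderiv ℝ f xₖ` along sequences `xₖ → x` of points of differentiability. -/
def clarkeSubdiff {E F : Type*} [NormedAddCommGroup E] [NormedSpace ℝ E]
    [NormedAddCommGroup F] [NormedSpace ℝ F] (f : E → F) (x : E) : Set (E →L[ℝ] F) :=
  convexHull ℝ {A | ∃ u : ℕ → E, Tendsto u atTop (nhds x) ∧
    (∀ k, DifferentiableAt ℝ f (u k)) ∧ Tendsto (fun k => fderiv ℝ f (u k)) atTop (nhds A)}

/-- The matrix of a continuous linear map. -/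
def clmMat {n m : ℕ} (A : EuclideanSpace ℝ (Fin n) →L[ℝ] (Fin m → ℝ)) :
    Matrix (Fin m) (Fin n) ℝ :=
  Matrix.of fun i j => A (EuclideanSpace.single j 1) i

/-- The Jacobian matrix of `f` at `x` (junk value where `f` is not differentiable). -/
def jacMat {n m : ℕ} (f : EuclideanSpace ℝ (Fin n) → (Fin m → ℝ)) (x : EuclideanSpace ℝ (Fin n)) :
    Matrix (Fin m) (Fin n) ℝ := clmMat (fderiv ℝ f x)

/-- Frobenius norm of a matrix. -/
noncomputable def mnorm {k l : ℕ} (A : Matrix (Fin k) (Fin l) ℝ) : ℝ :=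
  Real.sqrt (∑ i, ∑ j, A i j ^ 2)

/-- Euclidean norm of a vector given as a plain function. -/
noncomputable def vnorm {k : ℕ} (x : Fin k → ℝ) : ℝ :=
  Real.sqrt (∑ i, x i ^ 2)

/-- `D` is an open set which, near each boundary point and in suitable orthonormal
coordinates, coincides locally with the region strictly above the graph of a
Lipschitz function. -/
def IsLipschitzGraphDomain {m : ℕ} (D : Set (EuclideanSpace ℝ (Fin (m+1)))) : Prop :=
  IsOpen D ∧ ∀ z ∈ frontier D,
    ∃ (b : OrthonormalBasis (Fin (m+1)) ℝ (EuclideanSpace ℝ (Fin (m+1))))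
      (K : NNReal) (f : (Fin m → ℝ) → ℝ) (r : ℝ), 0 < r ∧ LipschitzWith K f ∧
      ∀ x ∈ Metric.ball z r,
        (x ∈ D ↔ f (fun i => b.repr x i.castSucc) < b.repr x (Fin.last m))

/-- `Aff*`: piecewise affine maps with maximal-rank constraint: for `n < m`, the Clarke
subgradients `A` satisfy `det (Aᵀ A) ≥ η > 0` uniformly; for `n = m`, `det ∇v > 0` a.e. -/
def AffStar {n m : ℕ} (v : EuclideanSpace ℝ (Fin n) → (Fin m → ℝ))
    (Ω : Set (EuclideanSpace ℝ (Fin n))) : Prop :=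
  PiecewiseAffineOn v Ω ∧
  ((n < m ∧ ∃ η > (0:ℝ), ∀ x ∈ Ω, ∀ A ∈ clarkeSubdiff v x,
      η ≤ ((clmMat A).transpose * clmMat A).det) ∨
   (∃ h : n = m, ∀ᵐ x ∂(volume.restrict Ω), DifferentiableAt ℝ v x ∧
      0 < ((jacMat v x).submatrix (finCongr h) id).det))

/-- Cross product in ℝ³. -/
def cross3 (u v : Fin 3 → ℝ) : Fin 3 → ℝ :=
  ![u 1 * v 2 - u 2 * v 1, u 2 * v 0 - u 0 * v 2, u 0 * v 1 - u 1 * v 0]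

/-- The 3×3 matrix `(A|ζ)` whose first two columns are those of `A` and last column is `ζ`. -/
def aug (A : Matrix (Fin 3) (Fin 2) ℝ) (ζ : Fin 3 → ℝ) : Matrix (Fin 3) (Fin 3) ℝ :=
  Matrix.of fun i j => if h : (j : ℕ) < 2 then A i ⟨j, h⟩ else ζ i

/-- The cross product `A¹ ∧ A²` of the two columns of `A`. -/
def crossCols (A : Matrix (Fin 3) (Fin 2) ℝ) : Fin 3 → ℝ :=
  cross3 (fun i => A i 0) (fun i => A i 1)

/-- The reduced energy density `W₀(A) := inf_ζ W(A|ζ)`. -/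
noncomputable def W0fun (W : Matrix (Fin 3) (Fin 3) ℝ → ℝ≥0∞) :
    Matrix (Fin 3) (Fin 2) ℝ → ℝ≥0∞ :=
  fun A => ⨅ ζ : Fin 3 → ℝ, W (aug A ζ)

/-- Rank-one convexity for extended-valued functions on 3×2 matrices. -/
def RankOneConvexENN (f : Matrix (Fin 3) (Fin 2) ℝ → ℝ≥0∞) : Prop :=
  ∀ (ξ ξ' : Matrix (Fin 3) (Fin 2) ℝ) (lam : ℝ), lam ∈ Set.Ioo (0:ℝ) 1 →
    (ξ - ξ').rank = 1 →
    f (lam • ξ + (1 - lam) • ξ') ≤ ENNReal.ofReal lam * f ξ + ENNReal.ofReal (1 - lam) * f ξ'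

/-- The rank-one convex envelope: the greatest rank-one convex function below `f`,
realized as the pointwise supremum of all rank-one convex functions below `f`. -/
noncomputable def rankOneEnv (f : Matrix (Fin 3) (Fin 2) ℝ → ℝ≥0∞) :
    Matrix (Fin 3) (Fin 2) ℝ → ℝ≥0∞ :=
  fun A => ⨆ g ∈ {g : Matrix (Fin 3) (Fin 2) ℝ → ℝ≥0∞ |
    RankOneConvexENN g ∧ ∀ B, g B ≤ f B}, g A

/-- The quasiconvex envelope: infimum of averages of `f(ξ + ∇φ)` over the unit ball of ℝ²,
among Lipschitz test functions vanishing on the boundary of the ball. -/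
noncomputable def qcEnv (f : Matrix (Fin 3) (Fin 2) ℝ → ℝ≥0∞) :
    Matrix (Fin 3) (Fin 2) ℝ → ℝ≥0∞ :=
  fun ξ =>
    ⨅ φ : {φ : EuclideanSpace ℝ (Fin 2) → Fin 3 → ℝ //
        (∃ K : NNReal, LipschitzWith K φ) ∧
        ∀ x ∈ Metric.sphere (0 : EuclideanSpace ℝ (Fin 2)) 1, φ x = 0},
      (volume (Metric.ball (0 : EuclideanSpace ℝ (Fin 2)) 1))⁻¹ *
        ∫⁻ x in Metric.ball (0 : EuclideanSpace ℝ (Fin 2)) 1, f (ξ + jacMat (φ.1) x)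


abbrev E2 := EuclideanSpace ℝ (Fin 2)
abbrev M32 := Matrix (Fin 3) (Fin 2) ℝ

lemma clmMat_cont : Continuous (clmMat : (E2 →L[ℝ] (Fin 3 → ℝ)) → M32) := by
  refine continuous_matrix fun i j => ?_
  show Continuous fun A : E2 →L[ℝ] (Fin 3 → ℝ) => A (EuclideanSpace.single j 1) i
  fun_prop

lemma jac_meas (φ : E2 → Fin 3 → ℝ) {F : M32 → ℝ≥0∞} (hF : Continuous F) :
    Measurable fun x => F (jacMat φ x) :=
  (hF.comp clmMat_cont).measurable.comp (measurable_fderiv ℝ φ)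

/-- rescaling -/
def Hs (c : E2) (r : ℝ) (x : E2) : E2 := r⁻¹ • (x - c)

lemma Hs_cont (c : E2) (r : ℝ) : Continuous (Hs c r) := by unfold Hs; fun_prop

def kr (r : ℝ) : ℝ≥0∞ := ENNReal.ofReal |(r⁻¹ ^ Module.finrank ℝ E2)⁻¹|

lemma map_Hs (c : E2) {r : ℝ} (hr : 0 < r) :
    Measure.map (Hs c r) volume = kr r • (volume : Measure E2) := by
  have h1 : Hs c r = (fun x => r⁻¹ • x) ∘ (fun x => x - c) := rfl
  rw [h1, ← Measure.map_map (by fun_prop) (by fun_prop)]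
  rw [(measurePreserving_sub_right (volume : Measure E2) c).map_eq]
  exact Measure.map_addHaar_smul _ (inv_ne_zero hr.ne')

lemma lint_Hs (c : E2) {r : ℝ} (hr : 0 < r) {S : Set E2} (hS : MeasurableSet S)
    {g : E2 → ℝ≥0∞} (hg : Measurable g) :
    ∫⁻ x in Hs c r ⁻¹' S, g (Hs c r x) = kr r * ∫⁻ x in S, g x := by
  rw [← setLIntegral_map hS hg (Hs_cont c r).measurable, map_Hs c hr]
  simp

lemma vol_Hs (c : E2) {r : ℝ} (hr : 0 < r) {S : Set E2} (hS : MeasurableSet S) :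
    volume (Hs c r ⁻¹' S) = kr r * volume S := by
  rw [← Measure.map_apply (Hs_cont c r).measurable hS, map_Hs c hr]
  simp

lemma fderiv_Hs (χ : E2 → Fin 3 → ℝ) (c : E2) {r : ℝ} (hr : 0 < r) (x : E2) :
    fderiv ℝ (fun y => r • χ (Hs c r y)) x = fderiv ℝ χ (Hs c r x) := by
  have h1 : (fun y => r • χ (Hs c r y)) = r • (fun y => χ (Hs c r y)) := rfl
  rw [h1, fderiv_const_smul_field]
  unfold Hs
  rw [Pi.smul_apply, fderiv_comp_sub (f := fun y => χ (r⁻¹ • y)), fderiv_comp_smul, smul_smul,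
    mul_inv_cancel₀ hr.ne', one_smul]

lemma lip_Hs {χ : E2 → Fin 3 → ℝ} {L : NNReal} (hχ : LipschitzWith L χ) (c : E2) {r : ℝ}
    (hr : 0 < r) : ∀ x y, ‖r • χ (Hs c r x) - r • χ (Hs c r y)‖ ≤ L * ‖x - y‖ := by
  intro x y
  have h := hχ.norm_sub_le (Hs c r x) (Hs c r y)
  have h2 : Hs c r x - Hs c r y = r⁻¹ • (x - y) := by
    unfold Hs; rw [← smul_sub]; simp
  rw [h2, norm_smul, Real.norm_of_nonneg (inv_pos.2 hr).le] at h
  rw [← smul_sub, norm_smul, Real.norm_of_nonneg hr.le]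
  calc r * ‖χ (Hs c r x) - χ (Hs c r y)‖ ≤ r * (L * (r⁻¹ * ‖x - y‖)) := by gcongr
    _ = L * ‖x - y‖ := by field_simp

lemma packing {K : Set E2} (hKc : Convex ℝ K) (hKo : IsOpen K) (hKb : Bornology.IsBounded K)
    (hKn : K.Nonempty) {χ : E2 → Fin 3 → ℝ} {L : NNReal} (hχ : LipschitzWith L χ)
    (hχ0 : ∀ x, x ∉ K → χ x = 0) {U : Set E2} (hU : IsOpen U) :
    ∃ Χ : E2 → Fin 3 → ℝ, (∃ L', LipschitzWith L' Χ) ∧ (∀ x, x ∉ U → Χ x = 0) ∧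
      ∀ F : M32 → ℝ≥0∞, Continuous F →
        (∫⁻ x in U, F (jacMat Χ x)) * volume K = volume U * ∫⁻ x in K, F (jacMat χ x) := by
  obtain ⟨R, hR0, hR⟩ : ∃ R > 0, closure K ⊆ Metric.closedBall 0 R := by
    obtain ⟨R, hR⟩ := hKb.subset_closedBall 0
    exact ⟨max R 1, by positivity, closure_minimal
      (hR.trans (Metric.closedBall_subset_closedBall (le_max_left _ _))) Metric.isClosed_closedBall⟩
  have hKpos : 0 < volume K := hKo.measure_pos _ hKn
  have hKfin : volume K ≠ ⊤ := hKb.measure_lt_top.ne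
  have hfr : volume (closure K \ K) = 0 := by
    have := hKc.addHaar_frontier (volume : Measure E2)
    rwa [hKo.frontier_eq] at this
  have hcl : (closure K : Set E2) =ᵐ[volume] K := by
    refine (ae_eq_set).2 ⟨hfr, ?_⟩
    rw [Set.sdiff_eq_empty.2 subset_closure]; simp
  have hKcl : volume (closure K) = volume K := measure_congr hcl
  -- Vitali
  let t : Set (E2 × ℝ) := {a | 0 < a.2 ∧ Metric.closedBall a.1 (R * a.2) ⊆ U}
  let B : E2 × ℝ → Set E2 := fun a => Hs a.1 a.2 ⁻¹' closure K
  have hBsub : ∀ a ∈ t, B a ⊆ Metric.closedBall a.1 (R * a.2) := by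
    rintro ⟨c, r⟩ ⟨hr, -⟩ x hx
    have := hR hx
    simp only [Hs, Metric.mem_closedBall, dist_zero_right, norm_smul, norm_inv,
      Real.norm_eq_abs, abs_of_pos hr] at this
    rw [Metric.mem_closedBall, dist_eq_norm]
    simp only at hr ⊢
    rw [inv_mul_le_iff₀ hr] at this
    linarith
  have hBmeas : ∀ a, MeasurableSet (B a) := fun a =>
    (isClosed_closure.preimage (Hs_cont _ _)).measurableSet
  obtain ⟨u, hut, huc, hud, hu0⟩ := Vitali.exists_disjoint_covering_ae (volume : Measure E2) U t
    ((volume (Metric.closedBall (0:E2) (3 * R)) / volume K).toNNReal)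
    (fun a => R * a.2) (fun a => a.1) B hBsub (by
      rintro ⟨c, r⟩ ⟨hr, -⟩
      simp only at hr
      have e1 : Metric.closedBall c (3 * (R * r)) = Hs c r ⁻¹' Metric.closedBall 0 (3 * R) := by
        ext x
        simp only [Hs, Metric.mem_closedBall, sub_zero, norm_smul, norm_inv,
          Real.norm_eq_abs, abs_of_pos hr, dist_eq_norm, Set.mem_preimage]
        rw [inv_mul_le_iff₀ hr]
        ring_nf
      show volume (Metric.closedBall c (3 * (R * r))) ≤ _ * volume (Hs c r ⁻¹' closure K)
      rw [e1, vol_Hs c hr Metric.isClosed_closedBall.measurableSet,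
        vol_Hs c hr isClosed_closure.measurableSet, hKcl, ENNReal.coe_toNNReal]
      · rw [mul_left_comm, ENNReal.div_mul_cancel hKpos.ne' hKfin]
      · exact ENNReal.div_ne_top (Metric.isBounded_closedBall.measure_lt_top.ne) hKpos.ne')
    (by
      rintro ⟨c, r⟩ ⟨hr, -⟩
      obtain ⟨z, hz⟩ := hKn
      refine ⟨c + r • z, mem_interior.2 ⟨Hs c r ⁻¹' K, ?_, hKo.preimage (Hs_cont _ _), ?_⟩⟩
      · exact Set.preimage_mono subset_closure
      · simp only [Set.mem_preimage, Hs]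
        simpa [smul_smul, inv_mul_cancel₀ (ne_of_gt hr)] using hz)
    (fun a _ => isClosed_closure.preimage (Hs_cont _ _))
    (by
      intro x hx ε hε
      obtain ⟨ρ, hρ, hρU⟩ := Metric.nhds_basis_closedBall.mem_iff.1 (hU.mem_nhds hx)
      refine ⟨(x, min ρ ε / R), ⟨by simp only; positivity, ?_⟩, ?_, rfl⟩
      · refine (Metric.closedBall_subset_closedBall ?_).trans hρU
        simp only
        rw [mul_div_cancel₀ _ hR0.ne']; exact min_le_left _ _
      · simp only
        rw [mul_div_cancel₀ _ hR0.ne']; exact min_le_right _ _)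
  have hBU : ∀ a ∈ u, B a ⊆ U := fun a ha => (hBsub a (hut ha)).trans (hut ha).2
  classical
  let Χ : E2 → Fin 3 → ℝ := fun x =>
    if h : ∃ a ∈ u, x ∈ B a then h.choose.2 • χ (Hs h.choose.1 h.choose.2 x) else 0
  have huniq : ∀ a ∈ u, ∀ b ∈ u, ∀ x, x ∈ B a → x ∈ B b → a = b := by
    intro a ha b hb x hxa hxb
    by_contra hab
    exact Set.disjoint_left.1 (hud ha hb hab) hxa hxb
  have hΧ : ∀ a ∈ u, ∀ x ∈ B a, Χ x = a.2 • χ (Hs a.1 a.2 x) := by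
    intro a ha x hx
    have h : ∃ a ∈ u, x ∈ B a := ⟨a, ha, hx⟩
    have : h.choose = a := huniq _ h.choose_spec.1 _ ha x h.choose_spec.2 hx
    simp only [Χ, dif_pos h, this]
  have hΧ0 : ∀ x, (¬ ∃ a ∈ u, x ∈ B a) → Χ x = 0 := fun x h => by simp only [Χ, dif_neg h]
  have hχa0 : ∀ a : E2 × ℝ, ∀ x, x ∉ B a → a.2 • χ (Hs a.1 a.2 x) = 0 := by
    intro a x hx
    rw [hχ0 _ (fun h => hx (subset_closure h)), smul_zero]
  have hhalf : ∀ x y, (∀ a ∈ u, x ∈ B a → y ∉ B a) → ‖Χ x‖ ≤ L * ‖x - y‖ := by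
    intro x y hxy
    by_cases h : ∃ a ∈ u, x ∈ B a
    · obtain ⟨a, ha, hx⟩ := h
      have := lip_Hs hχ a.1 (hut ha).1 x y
      rw [hχa0 a y (hxy a ha hx), sub_zero] at this
      rwa [hΧ a ha x hx]
    · rw [hΧ0 x h, norm_zero]; positivity
  refine ⟨Χ, ⟨2 * L, LipschitzWith.of_dist_le_mul fun x y => ?_⟩, ?_, ?_⟩
  · rw [dist_eq_norm, dist_eq_norm]
    push_cast
    by_cases h : ∃ a ∈ u, x ∈ B a ∧ y ∈ B a
    · obtain ⟨a, ha, hx, hy⟩ := h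
      rw [hΧ a ha x hx, hΧ a ha y hy]
      have := lip_Hs hχ a.1 (hut ha).1 x y
      have h3 : (0:ℝ) ≤ L * ‖x - y‖ := by positivity
      linarith
    · push Not at h
      have h1 := hhalf x y h
      have h2 := hhalf y x (fun a ha hy hx => h a ha hx hy)
      rw [norm_sub_rev y x] at h2
      have := norm_sub_le (Χ x) (Χ y)
      linarith
  · intro x hx
    exact hΧ0 x fun ⟨a, ha, hxa⟩ => hx (hBU a ha hxa)
  · intro F hF
    have hUae : (⋃ a ∈ u, B a : Set E2) =ᵐ[volume] U := by
      refine (ae_eq_set).2 ⟨?_, hu0⟩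
      rw [Set.sdiff_eq_empty.2 (Set.iUnion₂_subset hBU)]; simp
    have hvol : volume U = ∑' a : u, kr a.1.2 * volume K := by
      rw [← measure_congr hUae, measure_biUnion huc hud (fun a _ => hBmeas a)]
      refine tsum_congr fun a => ?_
      rw [vol_Hs _ (hut a.2).1 isClosed_closure.measurableSet, hKcl]
    have hint : ∫⁻ x in U, F (jacMat Χ x) = ∑' a : u, kr a.1.2 * ∫⁻ x in K, F (jacMat χ x) := by
      rw [← setLIntegral_congr hUae, lintegral_biUnion huc (fun a _ => hBmeas a) hud]
      refine tsum_congr fun a => ?_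
      obtain ⟨⟨c, r⟩, ha⟩ := a
      have hr : 0 < r := (hut ha).1
      have hBK : (B (c, r) : Set E2) =ᵐ[volume] Hs c r ⁻¹' K := by
        refine (ae_eq_set).2 ⟨?_, ?_⟩
        · show volume (Hs c r ⁻¹' closure K \ Hs c r ⁻¹' K) = 0
          rw [← Set.preimage_sdiff, vol_Hs c hr (isClosed_closure.measurableSet.diff
            hKo.measurableSet), hfr, mul_zero]
        · rw [Set.sdiff_eq_empty.2 (Set.preimage_mono subset_closure)]; simp
      simp only
      rw [setLIntegral_congr hBK, ← lint_Hs c hr hKo.measurableSet (jac_meas χ hF)]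
      refine setLIntegral_congr_fun (hKo.preimage (Hs_cont _ _)).measurableSet fun x hx => ?_
      have : Χ =ᶠ[nhds x] fun y => r • χ (Hs c r y) := by
        filter_upwards [(hKo.preimage (Hs_cont c r)).mem_nhds hx] with y hy
        exact hΧ (c, r) ha y (subset_closure hy)
      simp only [jacMat]
      rw [this.fderiv_eq, fderiv_Hs χ c hr]
    rw [hint, hvol, ENNReal.tsum_mul_right, ENNReal.tsum_mul_right]
    ring

abbrev BB : Set E2 := Metric.ball (0 : E2) 1

lemma BB_pos : volume BB ≠ 0 := (Metric.measure_ball_pos _ _ one_pos).ne'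
lemma BB_fin : volume BB ≠ ⊤ := Metric.isBounded_ball.measure_lt_top.ne

/-- cut a test function off outside the ball -/
lemma cutoff {φ : E2 → Fin 3 → ℝ} {L : NNReal} (hφ : LipschitzWith L φ)
    (h0 : ∀ x ∈ Metric.sphere (0 : E2) 1, φ x = 0) :
    ∃ ψ : E2 → Fin 3 → ℝ, LipschitzWith L ψ ∧ (∀ x, x ∉ BB → ψ x = 0) ∧
      ∀ x ∈ BB, jacMat ψ x = jacMat φ x := by
  classical
  have key : ∀ x ∈ BB, ∀ y, y ∉ BB → ‖φ x‖ ≤ L * dist x y := by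
    intro x hx y hy
    have hx' : ‖x‖ < 1 := by simpa using hx
    have hy' : 1 ≤ ‖y‖ := by simpa using hy
    have hc : ContinuousOn (fun t : ℝ => ‖x + t • (y - x)‖) (Set.Icc 0 1) := by fun_prop
    obtain ⟨t, ht, hte⟩ := intermediate_value_Icc (zero_le_one) hc
      (show (1:ℝ) ∈ Set.Icc _ _ by simpa using ⟨hx'.le, hy'⟩)
    have h1 := hφ.dist_le_mul x (x + t • (y - x))
    rw [h0 (x + t • (y - x)) (by simpa using hte), dist_zero_right] at h1
    refine h1.trans ?_
    gcongr
    rw [dist_eq_norm, dist_eq_norm]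
    have : x - (x + t • (y - x)) = t • (x - y) := by
      rw [← neg_sub x y, smul_neg]; abel
    rw [this, norm_smul, Real.norm_of_nonneg ht.1]
    exact mul_le_of_le_one_left (norm_nonneg _) ht.2
  refine ⟨fun x => if x ∈ BB then φ x else 0, LipschitzWith.of_dist_le_mul fun x y => ?_, ?_, ?_⟩
  · by_cases hx : x ∈ BB <;> by_cases hy : y ∈ BB
    · simpa only [if_pos hx, if_pos hy] using hφ.dist_le_mul x y
    · simpa only [if_pos hx, if_neg hy, dist_zero_right] using key x hx y hy
    · simpa only [if_pos hy, if_neg hx, dist_zero_left, dist_comm y x] using key y hy x hx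
    · simp only [if_neg hx, if_neg hy, dist_self]; positivity
  · intro x hx; simp only [if_neg hx]
  · intro x hx
    unfold jacMat
    congr 1
    apply Filter.EventuallyEq.fderiv_eq
    filter_upwards [Metric.isOpen_ball.mem_nhds hx] with y hy
    exact if_pos hy

lemma qc_le_ball (f : M32 → ℝ≥0∞) (ξ : M32) {φ : E2 → Fin 3 → ℝ} {L : NNReal}
    (hφ : LipschitzWith L φ) (h0 : ∀ x, x ∉ BB → φ x = 0) :
    qcEnv f ξ * volume BB ≤ ∫⁻ x in BB, f (ξ + jacMat φ x) := by
  have h := iInf_le (fun φ : {φ : E2 → Fin 3 → ℝ //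
        (∃ K : NNReal, LipschitzWith K φ) ∧
        ∀ x ∈ Metric.sphere (0 : E2) 1, φ x = 0} => (volume BB)⁻¹ *
        ∫⁻ x in BB, f (ξ + jacMat (φ.1) x)) ⟨φ, ⟨L, hφ⟩, fun x hx => h0 x (by
          simp only [Metric.mem_sphere, dist_zero_right] at hx
          simp [hx])⟩
  calc qcEnv f ξ * volume BB ≤ ((volume BB)⁻¹ * ∫⁻ x in BB, f (ξ + jacMat φ x)) * volume BB := by
        gcongr; exact h
    _ = _ := by rw [mul_right_comm, ENNReal.inv_mul_cancel BB_pos BB_fin, one_mul]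

lemma qc_exists (f : M32 → ℝ≥0∞) (ξ : M32) {c : ℝ≥0∞} (hc : qcEnv f ξ < c) :
    ∃ (φ : E2 → Fin 3 → ℝ) (L : NNReal), LipschitzWith L φ ∧ (∀ x, x ∉ BB → φ x = 0) ∧
      ∫⁻ x in BB, f (ξ + jacMat φ x) ≤ c * volume BB := by
  obtain ⟨⟨φ, ⟨L, hL⟩, h0⟩, hφ⟩ := iInf_lt_iff.1 hc
  obtain ⟨ψ, h1, h2, h3⟩ := cutoff hL h0
  refine ⟨ψ, L, h1, h2, ?_⟩
  rw [setLIntegral_congr_fun (g := fun x => f (ξ + jacMat φ x)) measurableSet_ball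
    (fun x hx => by simp only [h3 x hx])]
  calc _ = ((volume BB)⁻¹ * ∫⁻ x in BB, f (ξ + jacMat φ x)) * volume BB := by
        rw [mul_right_comm, ENNReal.inv_mul_cancel BB_pos BB_fin, one_mul]
    _ ≤ _ := by gcongr

lemma cont_shift {f : M32 → ℝ≥0∞} (hf : Continuous f) (ξ : M32) : Continuous fun M => f (ξ + M) :=
  hf.comp (continuous_const.add continuous_id)

lemma qc_le_K {f : M32 → ℝ≥0∞} (hf : Continuous f) (ξ : M32) {K : Set E2} (hKc : Convex ℝ K)
    (hKo : IsOpen K) (hKb : Bornology.IsBounded K)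
    (hKn : K.Nonempty) {χ : E2 → Fin 3 → ℝ} {L : NNReal} (hχ : LipschitzWith L χ)
    (hχ0 : ∀ x, x ∉ K → χ x = 0) :
    qcEnv f ξ * volume K ≤ ∫⁻ x in K, f (ξ + jacMat χ x) := by
  obtain ⟨X, ⟨L', hX⟩, hX0, hXi⟩ := packing hKc hKo hKb hKn hχ hχ0 (Metric.isOpen_ball : IsOpen BB)
  have h1 := hXi _ (cont_shift hf ξ)
  have h2 := qc_le_ball f ξ hX hX0
  have h3 : volume BB * (qcEnv f ξ * volume K) ≤ volume BB * ∫⁻ x in K, f (ξ + jacMat χ x) := by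
    rw [← h1]
    calc _ = (qcEnv f ξ * volume BB) * volume K := by ring
      _ ≤ _ := by gcongr
  exact (ENNReal.mul_le_mul_iff_right BB_pos BB_fin).1 h3

lemma qc_pieces {f : M32 → ℝ≥0∞} (hf : Continuous f) (ξ : M32) {K : Set E2} (hKc : Convex ℝ K)
    (hKo : IsOpen K) (hKb : Bornology.IsBounded K)
    (hKn : K.Nonempty) {φ : E2 → Fin 3 → ℝ} {L : NNReal} (hφ : LipschitzWith L φ)
    (hφ0 : ∀ x, x ∉ K → φ x = 0) {P : Fin 3 → Set E2} (hPo : ∀ i, IsOpen (P i))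
    (hPK : ∀ i, P i ⊆ K) (hPd : Pairwise (Function.onFun Disjoint P))
    (hP0 : volume (K \ ⋃ i, P i) = 0)
    (G : Fin 3 → E2 →L[ℝ] (Fin 3 → ℝ)) (hG : ∀ i, ∀ x ∈ P i, HasFDerivAt φ (G i) x)
    {b : Fin 3 → ℝ≥0∞} (hb : ∀ i, qcEnv f (ξ + clmMat (G i)) < b i) :
    qcEnv f ξ * volume K ≤ ∑ i, volume (P i) * b i := by
  have h1 : ∀ i, ∃ X : E2 → Fin 3 → ℝ, (∃ L', LipschitzWith L' X) ∧ (∀ x, x ∉ P i → X x = 0) ∧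
      ∫⁻ x in P i, f (ξ + clmMat (G i) + jacMat X x) ≤ volume (P i) * b i := by
    intro i
    obtain ⟨χ, L', hχ, hχ0, hχi⟩ := qc_exists f _ (hb i)
    obtain ⟨X, hX, hX0, hXi⟩ := packing (convex_ball _ _) (Metric.isOpen_ball : IsOpen BB)
      Metric.isBounded_ball ⟨0, by simp⟩ hχ hχ0 (hPo i)
    refine ⟨X, hX, hX0, ?_⟩
    have h2 := hXi _ (cont_shift hf (ξ + clmMat (G i)))
    rw [← ENNReal.mul_le_mul_iff_left BB_pos BB_fin, h2, mul_assoc]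
    gcongr
  choose X hXL hX0 hXi using h1
  choose L' hL' using hXL
  let Φ : E2 → Fin 3 → ℝ := fun x => φ x + (X 0 x + (X 1 x + X 2 x))
  have hΦ : LipschitzWith (L + (L' 0 + (L' 1 + L' 2))) Φ :=
    hφ.add ((hL' 0).add ((hL' 1).add (hL' 2)))
  have hΦ0 : ∀ x, x ∉ K → Φ x = 0 := by
    intro x hx
    have := fun i => hX0 i x (fun h => hx (hPK i h))
    simp [Φ, hφ0 x hx, this]
  refine (qc_le_K hf ξ hKc hKo hKb hKn hΦ hΦ0).trans ?_
  have hKae : (⋃ i, P i : Set E2) =ᵐ[volume] K := by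
    refine (ae_eq_set).2 ⟨?_, hP0⟩
    rw [Set.sdiff_eq_empty.2 (Set.iUnion_subset hPK)]; simp
  rw [← setLIntegral_congr hKae, lintegral_iUnion (fun i => (hPo i).measurableSet) hPd,
    tsum_fintype]
  refine Finset.sum_le_sum fun i _ => ?_
  refine le_of_eq_of_le ?_ (hXi i)
  refine setLIntegral_congr_fun_ae (hPo i).measurableSet ?_
  filter_upwards [(hL' i).ae_differentiableAt (μ := volume)] with x hdx hx
  have hloc : Φ =ᶠ[nhds x] fun y => φ y + X i y := by
    filter_upwards [(hPo i).mem_nhds hx] with y hy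
    have h0 : ∀ j, j ≠ i → X j y = 0 := fun j hj =>
      hX0 j y (fun h => Set.disjoint_left.1 (hPd hj) h hy)
    fin_cases i
    · simp [Φ, h0 1 (by decide), h0 2 (by decide)]
    · simp [Φ, h0 0 (by decide), h0 2 (by decide)]
    · simp [Φ, h0 0 (by decide), h0 1 (by decide)]
  have hd : fderiv ℝ Φ x = G i + fderiv ℝ (X i) x := by
    rw [hloc.fderiv_eq]
    exact ((hG i x hx).add hdx.hasFDerivAt).fderiv
  have : jacMat Φ x = clmMat (G i) + jacMat (X i) x := by
    unfold jacMat; rw [hd]; rfl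
  rw [this, add_assoc]

/-- mean zero of gradients -/
lemma jac_mean {K : Set E2} (hKc : Convex ℝ K)
    (hKo : IsOpen K) (hKb : Bornology.IsBounded K) {φ : E2 → Fin 3 → ℝ} {L : NNReal}
    (hφ : LipschitzWith L φ)
    (hφ0 : ∀ x, x ∉ K → φ x = 0) (i : Fin 3) (j : Fin 2) :
    IntegrableOn (fun x => jacMat φ x i j) K ∧ ∫ x in K, jacMat φ x i j = 0 := by
  have hm : Measurable (fun x => jacMat φ x i j) := by
    have hc : Continuous (fun A : E2 →L[ℝ] (Fin 3 → ℝ) => clmMat A i j) :=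
      (continuous_apply_apply i j).comp clmMat_cont
    exact hc.measurable.comp (measurable_fderiv ℝ φ)
  have hbd : ∀ x, ‖jacMat φ x i j‖ ≤ L := by
    intro x
    have h1 := norm_fderiv_le_of_lipschitz ℝ (x₀ := x) hφ
    have h2 := (fderiv ℝ φ x).le_opNorm (EuclideanSpace.single j 1)
    have h3 := norm_le_pi_norm (fderiv ℝ φ x (EuclideanSpace.single j 1)) i
    have h4 : ‖(EuclideanSpace.single j 1 : E2)‖ = 1 := by simp
    rw [h4, mul_one] at h2
    exact h3.trans (h2.trans h1)
  refine ⟨Measure.integrableOn_of_bounded hKb.measure_lt_top.ne hm.aestronglyMeasurable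
    (Filter.Eventually.of_forall hbd), ?_⟩
  set g : E2 → ℝ := fun x => φ x i with hg
  have hgL : LipschitzWith L g := LipschitzWith.of_dist_le_mul fun x y =>
    (dist_le_pi_dist _ _ i).trans (hφ.dist_le_mul x y)
  have hgs : HasCompactSupport g := by
    refine HasCompactSupport.intro (hKb.isCompact_closure) fun x hx => ?_
    simp [hg, hφ0 x (fun h => hx (subset_closure h))]
  have h := LipschitzWith.integral_lineDeriv_mul_eq (μ := (volume : Measure E2))
    (LipschitzWith.const (1:ℝ)) hgL hgs (-EuclideanSpace.single j 1)
  have hcst : ∀ x : E2, lineDeriv ℝ (fun _ : E2 => (1:ℝ)) x (-EuclideanSpace.single j 1) = 0 := by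
    intro x; simp [lineDeriv]
  simp only [mul_one, neg_neg, hcst, zero_mul, integral_zero] at h
  have h2 : ∫ x, lineDeriv ℝ g x (EuclideanSpace.single j 1) = ∫ x, jacMat φ x i j := by
    refine integral_congr_ae ?_
    filter_upwards [hφ.ae_differentiableAt (μ := volume)] with x hx
    have h5 : HasFDerivAt g ((ContinuousLinearMap.proj i).comp (fderiv ℝ φ x)) x :=
      (hasFDerivAt_pi'.1 hx.hasFDerivAt) i
    rw [(h5.hasLineDerivAt _).lineDeriv]
    rfl
  rw [setIntegral_eq_integral_of_ae_compl_eq_zero, ← h2, ← h]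
  have hfr := measure_eq_zero_iff_ae_notMem.1 (hKc.addHaar_frontier (volume : Measure E2))
  filter_upwards [hfr] with x hx hxK
  have : x ∉ closure K := fun hc => hx (by rw [hKo.frontier_eq]; exact ⟨hc, hxK⟩)
  have h0 : φ =ᶠ[nhds x] fun _ => 0 := by
    filter_upwards [isClosed_closure.isOpen_compl.mem_nhds this] with y hy
    exact hφ0 y (fun h => hy (subset_closure h))
  simp [jacMat, h0.fderiv_eq, clmMat]

def ell (g : Fin 2 → ℝ) : E2 →L[ℝ] ℝ := g 0 • EuclideanSpace.proj 0 + g 1 • EuclideanSpace.proj 1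

lemma ell_apply (g : Fin 2 → ℝ) (x : E2) : ell g x = g 0 * x 0 + g 1 * x 1 := by
  simp [ell]

lemma clmMat_ell (g : Fin 2 → ℝ) (a : Fin 3 → ℝ) :
    clmMat ((ell g).smulRight a) = Matrix.vecMulVec a g := by
  ext k j
  fin_cases j <;> simp [clmMat, ell_apply, Matrix.vecMulVec_apply, mul_comm]

lemma ell_null {g h : Fin 2 → ℝ} (hgh : g ≠ h) : volume {x : E2 | ell g x = ell h x} = 0 := by
  have h1 : {x : E2 | ell g x = ell h x} = ((ell g - ell h).ker : Submodule ℝ E2) := by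
    ext x; simp [sub_eq_zero]
  rw [h1]
  refine Measure.addHaar_submodule _ _ fun htop => hgh ?_
  have h2 : ∀ x : E2, ell g x = ell h x := fun x => by
    have : x ∈ ((ell g - ell h).ker : Submodule ℝ E2) := by rw [htop]; trivial
    simpa [sub_eq_zero] using this
  ext j
  have := h2 (EuclideanSpace.single j 1)
  fin_cases j <;> simpa [ell_apply] using this

lemma tri_geom (g : Fin 3 → Fin 2 → ℝ) (w : Fin 3 → ℝ) (hw : ∀ i, 0 < w i)
    (hs : w 0 + w 1 + w 2 = 1) (hwg : ∀ j, w 0 * g 0 j + w 1 * g 1 j + w 2 * g 2 j = 0)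
    (hD : g 0 0 * g 1 1 - g 0 1 * g 1 0 ≠ 0) :
    ∃ (K : Set E2) (P : Fin 3 → Set E2), Convex ℝ K ∧ IsOpen K ∧ Bornology.IsBounded K ∧
      K.Nonempty ∧ (∀ i, IsOpen (P i)) ∧ (∀ i, P i ⊆ K) ∧ Pairwise (Function.onFun Disjoint P) ∧
      volume (K \ ⋃ i, P i) = 0 ∧ (∀ i, volume (P i) = ENNReal.ofReal (w i) * volume K) ∧
      ∀ a : Fin 3 → ℝ, ∃ (φ : E2 → Fin 3 → ℝ) (L : NNReal), LipschitzWith L φ ∧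
        (∀ x, x ∉ K → φ x = 0) ∧ ∀ i, ∀ x ∈ P i, HasFDerivAt φ ((ell (g i)).smulRight a) x := by
  have hw0 := hw 0
  have hw1 := hw 1
  have hw2 := hw 2
  have hg0 := hwg 0
  have hg1 := hwg 1
  let l : Fin 3 → E2 → ℝ := fun i x => 1 + ell (g i) x
  have hlc : ∀ i, Continuous (l i) := fun i => by fun_prop
  let K : Set E2 := {x | ∀ i, 0 < l i x}
  let P : Fin 3 → Set E2 := fun i => {x | (∀ j, 0 < l j x) ∧ ∀ j, j ≠ i → l i x < l j x}
  have hKo : IsOpen K := by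
    simp only [K, Set.ofPred_forall]
    exact isOpen_iInter_of_finite fun i => isOpen_lt continuous_const (hlc i)
  have hKc : Convex ℝ K := by
    simp only [K, Set.ofPred_forall]
    refine convex_iInter fun i => ?_
    have : {x | 0 < l i x} = {x | -1 < ell (g i) x} := by
      ext x; simp only [l, Set.mem_ofPred_eq]; constructor <;> intro h <;> linarith
    rw [this]
    exact convex_halfSpace_gt (ell (g i)).toLinearMap.isLinear _
  have hsum : ∀ x, w 0 * ell (g 0) x + w 1 * ell (g 1) x + w 2 * ell (g 2) x = 0 := by
    intro x; simp only [ell_apply]; linear_combination x 0 * hg0 + x 1 * hg1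
  have hKb : Bornology.IsBounded K := by
    rw [isBounded_iff_forall_norm_le]
    refine ⟨(1 / w 0 * |g 1 1| + 1 / w 1 * |g 0 1|) / |g 0 0 * g 1 1 - g 0 1 * g 1 0| +
      (1 / w 0 * |g 1 0| + 1 / w 1 * |g 0 0|) / |g 0 0 * g 1 1 - g 0 1 * g 1 0|, fun x hx => ?_⟩
    have k0 : 0 < 1 + ell (g 0) x := hx 0
    have k1 : 0 < 1 + ell (g 1) x := hx 1
    have k2 : 0 < 1 + ell (g 2) x := hx 2
    have ks := hsum x
    have b0 : |ell (g 0) x| ≤ 1 / w 0 := by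
      rw [abs_le, le_div_iff₀ hw0, neg_le, ← sub_nonneg]
      constructor
      · have : 1 ≤ 1 / w 0 := by rw [le_div_iff₀ hw0]; linarith
        linarith
      · nlinarith [mul_pos hw0 k0, mul_pos hw1 k1, mul_pos hw2 k2]
    have b1 : |ell (g 1) x| ≤ 1 / w 1 := by
      rw [abs_le, le_div_iff₀ hw1, neg_le, ← sub_nonneg]
      constructor
      · have : 1 ≤ 1 / w 1 := by rw [le_div_iff₀ hw1]; linarith
        linarith
      · nlinarith [mul_pos hw0 k0, mul_pos hw1 k1, mul_pos hw2 k2]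
    have hDp : 0 < |g 0 0 * g 1 1 - g 0 1 * g 1 0| := abs_pos.2 hD
    have hx0 : |x 0| ≤ (1 / w 0 * |g 1 1| + 1 / w 1 * |g 0 1|) /
        |g 0 0 * g 1 1 - g 0 1 * g 1 0| := by
      rw [le_div_iff₀ hDp, ← abs_mul]
      have : x 0 * (g 0 0 * g 1 1 - g 0 1 * g 1 0) =
        ell (g 0) x * g 1 1 - ell (g 1) x * g 0 1 := by simp only [ell_apply]; ring
      rw [this]
      refine (abs_sub _ _).trans ?_
      rw [abs_mul, abs_mul]; gcongr
    have hx1 : |x 1| ≤ (1 / w 0 * |g 1 0| + 1 / w 1 * |g 0 0|) /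
        |g 0 0 * g 1 1 - g 0 1 * g 1 0| := by
      rw [le_div_iff₀ hDp, ← abs_mul]
      have : x 1 * (g 0 0 * g 1 1 - g 0 1 * g 1 0) =
        ell (g 1) x * g 0 0 - ell (g 0) x * g 1 0 := by simp only [ell_apply]; ring
      rw [this]
      refine (abs_sub _ _).trans ?_
      rw [abs_mul, abs_mul, add_comm]; gcongr
    have hn : ‖x‖ ≤ |x 0| + |x 1| := by
      rw [EuclideanSpace.norm_eq, Fin.sum_univ_two]
      refine Real.sqrt_le_iff.2 ⟨by positivity, ?_⟩
      simp only [Real.norm_eq_abs]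
      nlinarith [abs_nonneg (x 0), abs_nonneg (x 1)]
    linarith
  have hKn : K.Nonempty := ⟨0, fun i => by simp [l]⟩
  have hPo : ∀ i, IsOpen (P i) := by
    intro i
    refine hKo.inter ?_
    show IsOpen {x | ∀ j, j ≠ i → l i x < l j x}
    simp only [Set.ofPred_forall]
    exact isOpen_iInter_of_finite fun j => isOpen_iInter_of_finite fun _ =>
      isOpen_lt (hlc i) (hlc j)
  have hPK : ∀ i, P i ⊆ K := fun i x hx => hx.1
  have hPd : Pairwise (Function.onFun Disjoint P) := by
    intro i j hij
    refine Set.disjoint_left.2 fun x hi hj => ?_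
    exact lt_asymm (hi.2 j hij.symm) (hj.2 i hij)
  have hne : ∀ i j, i ≠ j → g i ≠ g j := by
    have e01 : g 0 ≠ g 1 := fun h => hD (by rw [h]; ring)
    have e02 : g 0 ≠ g 2 := fun h => hD (by
      rw [← h] at hg0 hg1
      have : w 1 * (g 0 0 * g 1 1 - g 0 1 * g 1 0) = 0 := by
        linear_combination g 0 0 * hg1 - g 0 1 * hg0
      exact (mul_eq_zero.1 this).resolve_left hw1.ne')
    have e12 : g 1 ≠ g 2 := fun h => hD (by
      rw [← h] at hg0 hg1
      have : w 0 * (g 0 0 * g 1 1 - g 0 1 * g 1 0) = 0 := by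
        linear_combination g 1 1 * hg0 - g 1 0 * hg1
      exact (mul_eq_zero.1 this).resolve_left hw0.ne')
    intro i j hij
    fin_cases i <;> fin_cases j <;> first | exact absurd rfl hij | assumption | (symm; assumption)
  have hP0 : volume (K \ ⋃ i, P i) = 0 := by
    refine measure_mono_null (t := ⋃ i, ⋃ j, ⋃ (_ : i ≠ j), {x : E2 | ell (g i) x = ell (g j) x})
      ?_ ?_
    · rintro x ⟨hxK, hxP⟩
      by_contra hx
      simp only [Set.mem_iUnion, Set.mem_ofPred_eq, not_exists] at hx hxP
      obtain ⟨i, hi⟩ := Finite.exists_min (fun i => l i x)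
      refine hxP i ⟨hxK, fun j hj => lt_of_le_of_ne (hi j) fun h => hx i j hj.symm ?_⟩
      simpa [l] using h
    · simp only [measure_iUnion_null_iff]
      intro i j hij
      exact ell_null (hne i j hij)
  have hφ : ∀ a : Fin 3 → ℝ, ∃ (φ : E2 → Fin 3 → ℝ) (L : NNReal), LipschitzWith L φ ∧
        (∀ x, x ∉ K → φ x = 0) ∧ ∀ i, ∀ x ∈ P i, HasFDerivAt φ ((ell (g i)).smulRight a) x := by
    intro a
    let ψ : E2 → ℝ := fun x => max 0 (min (l 0 x) (min (l 1 x) (l 2 x)))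
    have hlL : ∀ i, LipschitzWith (0 + ‖ell (g i)‖₊) (l i) := fun i =>
      (LipschitzWith.const 1).add (ell (g i)).lipschitz
    have hψL := ((hlL 0).min ((hlL 1).min (hlL 2))).const_max 0
    refine ⟨fun x => ψ x • a, _,
      (ContinuousLinearMap.toSpanSingleton ℝ a).lipschitz.comp hψL, ?_, ?_⟩
    · intro x hx
      have : ψ x = 0 := by
        refine max_eq_left ?_
        by_contra hc
        push Not at hc
        simp only [lt_min_iff] at hc
        exact hx fun i => by fin_cases i <;> simp [hc]
      simp [this]
    · intro i x hx
      have h1 : HasFDerivAt (l i) (ell (g i)) x := (ell (g i)).hasFDerivAt.const_add 1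
      have h2 : (fun x => ψ x • a) =ᶠ[nhds x] fun y => l i y • a := by
        filter_upwards [(hPo i).mem_nhds hx] with y hy
        have : ψ y = l i y := by
          have h3 := hy.1 i
          have hle : ∀ j, l i y ≤ l j y := fun j => by
            by_cases hj : j = i
            · rw [hj]
            · exact (hy.2 j hj).le
          have h4 : min (l 0 y) (min (l 1 y) (l 2 y)) = l i y := by
            refine le_antisymm ?_ (le_min (hle 0) (le_min (hle 1) (hle 2)))
            fin_cases i <;> simp
          simp only [ψ, h4]
          exact max_eq_right h3.le
        rw [this]
      exact (h1.smul_const a).congr_of_eventuallyEq h2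
  refine ⟨K, P, hKc, hKo, hKb, hKn, hPo, hPK, hPd, hP0, ?_, hφ⟩
  have hKfin : volume K ≠ ⊤ := hKb.measure_lt_top.ne
  have hPfin : ∀ i, volume (P i) ≠ ⊤ := fun i => measure_ne_top_of_subset (hPK i) hKfin
  have hKae : (⋃ i, P i : Set E2) =ᵐ[volume] K := by
    refine (ae_eq_set).2 ⟨?_, hP0⟩
    rw [Set.sdiff_eq_empty.2 (Set.iUnion_subset hPK)]; simp
  have hV : (volume K).toReal = (volume (P 0)).toReal + (volume (P 1)).toReal +
      (volume (P 2)).toReal := by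
    rw [← measure_congr hKae, measure_iUnion hPd (fun i => (hPo i).measurableSet), tsum_fintype,
      ENNReal.toReal_sum (fun i _ => hPfin i), Fin.sum_univ_three]
  have hM : ∀ j, (volume (P 0)).toReal * g 0 j + (volume (P 1)).toReal * g 1 j +
      (volume (P 2)).toReal * g 2 j = 0 := by
    intro j
    obtain ⟨φ, L, hL, h0, hd⟩ := hφ (fun _ => 1)
    obtain ⟨hi, hz⟩ := jac_mean hKc hKo hKb hL h0 0 j
    rw [← setIntegral_congr_set hKae, integral_iUnion_fintype (fun i => (hPo i).measurableSet) hPd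
      (fun i => hi.mono_set (hPK i))] at hz
    have : ∀ i, ∫ x in P i, jacMat φ x 0 j = (volume (P i)).toReal * g i j := by
      intro i
      rw [setIntegral_congr_fun (g := fun _ => g i j) (hPo i).measurableSet]
      · simp [Measure.real]
      · intro x hx
        simp only [jacMat, (hd i x hx).fderiv, clmMat_ell, Matrix.vecMulVec_apply, one_mul]
    rw [← hz, Fin.sum_univ_three, this, this, this]
  have m0 := hM 0
  have m1 := hM 1
  set V := (volume K).toReal
  set p0 := (volume (P 0)).toReal with hp0
  set p1 := (volume (P 1)).toReal with hp1
  set p2 := (volume (P 2)).toReal with hp2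
  -- p_k * w_2 = p_2 * w_k
  have q0 : p0 * w 2 = p2 * w 0 := by
    have : (p0 * w 2 - p2 * w 0) * (g 0 0 * g 1 1 - g 0 1 * g 1 0) = 0 := by
      linear_combination (w 2 * g 1 1) * m0 - (w 2 * g 1 0) * m1 - (p2 * g 1 1) * hg0
        + (p2 * g 1 0) * hg1
    linarith [(mul_eq_zero.1 this).resolve_right hD]
  have q1 : p1 * w 2 = p2 * w 1 := by
    have : (p1 * w 2 - p2 * w 1) * (g 0 0 * g 1 1 - g 0 1 * g 1 0) = 0 := by
      linear_combination (w 2 * g 0 0) * m1 - (w 2 * g 0 1) * m0 - (p2 * g 0 0) * hg1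
        + (p2 * g 0 1) * hg0
    linarith [(mul_eq_zero.1 this).resolve_right hD]
  have q2 : p2 = w 2 * V := by
    rw [hV]; linear_combination (-p2) * hs - q0 - q1
  have q0' : p0 = w 0 * V := by
    have : w 2 * (p0 - w 0 * V) = 0 := by rw [q2] at q0; linear_combination q0
    linarith [(mul_eq_zero.1 this).resolve_left hw2.ne']
  have q1' : p1 = w 1 * V := by
    have : w 2 * (p1 - w 1 * V) = 0 := by rw [q2] at q1; linear_combination q1
    linarith [(mul_eq_zero.1 this).resolve_left hw2.ne']
  intro i
  rw [← ENNReal.ofReal_toReal (hPfin i), ← ENNReal.ofReal_toReal hKfin,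
    ← ENNReal.ofReal_mul (hw i).le]
  congr 1
  fin_cases i
  · exact q0'
  · exact q1'
  · exact q2

lemma qc_tri {f : M32 → ℝ≥0∞} (hf : Continuous f) (ξ : M32) (a : Fin 3 → ℝ)
    (g : Fin 3 → Fin 2 → ℝ) (w : Fin 3 → ℝ) (hw : ∀ i, 0 < w i)
    (hs : w 0 + w 1 + w 2 = 1) (hwg : ∀ j, w 0 * g 0 j + w 1 * g 1 j + w 2 * g 2 j = 0)
    (hD : g 0 0 * g 1 1 - g 0 1 * g 1 0 ≠ 0)
    {b : Fin 3 → ℝ≥0∞} (hb : ∀ i, qcEnv f (ξ + Matrix.vecMulVec a (g i)) < b i) :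
    qcEnv f ξ ≤ ∑ i, ENNReal.ofReal (w i) * b i := by
  obtain ⟨K, P, hKc, hKo, hKb, hKn, hPo, hPK, hPd, hP0, hPw, hφ⟩ := tri_geom g w hw hs hwg hD
  obtain ⟨φ, L, hL, h0, hd⟩ := hφ a
  have h := qc_pieces hf ξ hKc hKo hKb hKn hL h0 hPo hPK hPd hP0 _ hd
    (b := b) (by simpa only [clmMat_ell] using hb)
  have hKpos : volume K ≠ 0 := (hKo.measure_pos _ hKn).ne'
  have hKfin : volume K ≠ ⊤ := hKb.measure_lt_top.ne
  rw [← ENNReal.mul_le_mul_iff_left hKpos hKfin]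
  refine h.trans_eq ?_
  rw [Finset.sum_mul]
  refine Finset.sum_congr rfl fun i _ => ?_
  rw [hPw]; ring

lemma qc_le_self (f : M32 → ℝ≥0∞) (ξ : M32) : qcEnv f ξ ≤ f ξ := by
  have h := qc_le_ball f ξ (φ := fun _ => 0) (LipschitzWith.const (0 : Fin 3 → ℝ))
    (fun _ _ => rfl)
  have h2 : ∀ x, jacMat (fun _ : E2 => (0 : Fin 3 → ℝ)) x = 0 := by
    intro x; ext i j; simp [jacMat, clmMat]
  simp only [h2, add_zero, lintegral_const, Measure.restrict_apply_univ] at h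
  exact (ENNReal.mul_le_mul_iff_left BB_pos BB_fin).1 h

lemma qc_fin_tri {f : M32 → ℝ≥0∞} (hf : Continuous f) (ξ : M32) (a : Fin 3 → ℝ)
    (g : Fin 3 → Fin 2 → ℝ) (hg : ∀ j, g 0 j + g 1 j + g 2 j = 0)
    (hD : g 0 0 * g 1 1 - g 0 1 * g 1 0 ≠ 0)
    (h : ∀ i, qcEnv f (ξ + Matrix.vecMulVec a (g i)) ≠ ⊤) : qcEnv f ξ ≠ ⊤ := by
  have := qc_tri hf ξ a g (fun _ => 1 / 3) (fun _ => by norm_num) (by norm_num)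
    (fun j => by linear_combination (1 / 3) * hg j) hD
    (b := fun i => qcEnv f (ξ + Matrix.vecMulVec a (g i)) + 1)
    (fun i => ENNReal.lt_add_right (h i) one_ne_zero)
  refine ne_top_of_le_ne_top ?_ this
  refine ENNReal.sum_ne_top.2 fun i _ => ENNReal.mul_ne_top ENNReal.ofReal_ne_top ?_
  exact ENNReal.add_ne_top.2 ⟨h i, ENNReal.one_ne_top⟩

lemma qc_fin1 {f : M32 → ℝ≥0∞} (hf : Continuous f)
    (htop : ∀ A, crossCols A ≠ 0 → f A ≠ ⊤) (ξ : M32) (k : Fin 3) (hk : ξ k 0 ≠ 0) :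
    qcEnv f ξ ≠ ⊤ := by
  by_cases hc : crossCols ξ = 0
  · have c0 := congrFun hc 0
    have c1 := congrFun hc 1
    have c2 := congrFun hc 2
    simp [crossCols, cross3] at c0 c1 c2
    obtain ⟨c, hcc⟩ : ∃ c, c * ξ k 0 = ξ k 1 := ⟨ξ k 1 / ξ k 0, by field_simp⟩
    refine qc_fin_tri hf ξ (Pi.single (k + 1) 1) ![![0, 2], ![1, c - 1], ![-1, -c - 1]]
      (fun j => by
        fin_cases j
        · simp
        · simp; ring) (by simp) ?_
    have key : ∀ s t : ℝ, t ≠ 0 →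
        qcEnv f (ξ + Matrix.vecMulVec (Pi.single (k + 1) 1) ![s, c * s + t]) ≠ ⊤ := by
      intro s t ht
      refine ne_top_of_le_ne_top (htop _ ?_) (qc_le_self f _)
      intro h0
      refine mul_ne_zero hk ht ?_
      fin_cases k
      · have := congrFun h0 2
        simp [crossCols, cross3, Matrix.vecMulVec_apply] at this hcc
        show ξ 0 0 * t = 0
        linear_combination this - c2 - s * hcc
      · have := congrFun h0 0
        simp [crossCols, cross3, Matrix.vecMulVec_apply] at this hcc
        show ξ 1 0 * t = 0
        linear_combination this - c0 - s * hcc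
      · have := congrFun h0 1
        simp [crossCols, cross3, Matrix.vecMulVec_apply] at this hcc
        show ξ 2 0 * t = 0
        linear_combination this - c1 - s * hcc
    intro i
    fin_cases i
    · simpa using key 0 2 (by norm_num)
    · simpa [sub_eq_add_neg] using key 1 (-1) (by norm_num)
    · simpa [sub_eq_add_neg] using key (-1) (-1) (by norm_num)
  · exact ne_top_of_le_ne_top (htop _ hc) (qc_le_self f _)

lemma qc_fin {f : M32 → ℝ≥0∞} (hf : Continuous f)
    (htop : ∀ A, crossCols A ≠ 0 → f A ≠ ⊤) (ξ : M32) : qcEnv f ξ ≠ ⊤ := by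
  by_cases h : ξ 0 0 = 0
  · refine qc_fin_tri hf ξ (Pi.single 0 1) ![![2, 0], ![-1, 1], ![-1, -1]]
      (fun j => by
        fin_cases j
        · show (2:ℝ) + -1 + -1 = 0
          norm_num
        · show (0:ℝ) + 1 + -1 = 0
          norm_num) (by simp) ?_
    intro i
    refine qc_fin1 hf htop _ 0 ?_
    fin_cases i <;> simp [Matrix.vecMulVec_apply, h]
  · exact qc_fin1 hf htop ξ 0 h

lemma seg_of_tri (k : ℝ → ℝ → ℝ)
    (H : ∀ w0 w1 w2 s0 t0 s1 t1 s2 t2 s t : ℝ, 0 < w0 → 0 < w1 → 0 < w2 → w0 + w1 + w2 = 1 →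
      s = w0 * s0 + w1 * s1 + w2 * s2 → t = w0 * t0 + w1 * t1 + w2 * t2 →
      (s0 - s) * (t1 - t) - (t0 - t) * (s1 - s) ≠ 0 →
      k s t ≤ w0 * k s0 t0 + w1 * k s1 t1 + w2 * k s2 t2)
    (μ : ℝ) (h0 : 0 < μ) (h1 : μ < 1) : k μ 0 ≤ (1 - μ) * k 0 0 + μ * k 1 0 := by
  let R : ℝ → ℝ := fun δ => (1 - δ) * ((1 - δ) * ((1 - μ / (1 - δ) ^ 2) * k 0 0 +
    μ / (1 - δ) ^ 2 * k 1 0) + δ * ((k 0 1 + k 0 (-1)) / 2)) + δ * k 0 0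
  have hm : ContinuousAt (fun δ : ℝ => μ / (1 - δ) ^ 2) 0 := by
    refine ContinuousAt.div (by fun_prop) (by fun_prop) (by norm_num)
  have hR : Tendsto R (nhdsWithin 0 (Set.Ioi 0)) (nhds ((1 - μ) * k 0 0 + μ * k 1 0)) := by
    have h2 : ContinuousAt R 0 := by
      simp only [R]
      fun_prop
    have h3 : R 0 = (1 - μ) * k 0 0 + μ * k 1 0 := by simp [R]
    rw [← h3]
    exact h2.mono_left nhdsWithin_le_nhds
  refine ge_of_tendsto hR ?_
  have e1 : ∀ᶠ δ in nhdsWithin (0:ℝ) (Set.Ioi 0), μ / (1 - δ) ^ 2 < 1 :=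
    nhdsWithin_le_nhds (hm.eventually_lt continuousAt_const (by simpa using h1))
  have e2 : ∀ᶠ δ in nhdsWithin (0:ℝ) (Set.Ioi 0), δ < 1 :=
    nhdsWithin_le_nhds (eventually_lt_nhds one_pos)
  filter_upwards [e1, e2, self_mem_nhdsWithin] with δ hδm hδ1 hδ0
  have hδ0 : 0 < δ := hδ0
  simp only [R]
  have hd : 0 < 1 - δ := by linarith
  set m := μ / (1 - δ) ^ 2 with hmdef
  have hμ : μ = (1 - δ) * ((1 - δ) * m) := by rw [hmdef]; field_simp
  have hm0 : 0 < m := by positivity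
  have hm1 : 0 < 1 - m := by linarith
  have A := H ((1 - δ) * (1 - m)) ((1 - δ) * m) δ 0 0 1 0 0 1 ((1 - δ) * m) δ (by positivity)
    (by positivity) hδ0 (by ring) (by ring) (by ring) (by
      have : (0 - (1 - δ) * m) * (0 - δ) - (0 - δ) * (1 - (1 - δ) * m) = δ := by ring
      rw [this]; exact hδ0.ne')
  have B := H ((1 - δ) * (1 - m)) ((1 - δ) * m) δ 0 0 1 0 0 (-1) ((1 - δ) * m) (-δ) (by positivity)
    (by positivity) hδ0 (by ring) (by ring) (by ring) (by
      have : (0 - (1 - δ) * m) * (0 - -δ) - (0 - -δ) * (1 - (1 - δ) * m) = -δ := by ring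
      rw [this]; exact (neg_lt_zero.2 hδ0).ne)
  have C := H ((1 - δ) / 2) ((1 - δ) / 2) δ ((1 - δ) * m) δ ((1 - δ) * m) (-δ) 0 0 μ 0 (by positivity)
    (by positivity) hδ0 (by ring) (by rw [hμ]; ring) (by ring) (by
      have : ((1 - δ) * m - μ) * (-δ - 0) - (δ - 0) * ((1 - δ) * m - μ) =
        -(2 * δ * (δ * ((1 - δ) * m))) := by rw [hμ]; ring
      rw [this]
      have : 0 < 2 * δ * (δ * ((1 - δ) * m)) := by positivity
      linarith)
  have A' := mul_le_mul_of_nonneg_left A (by positivity : 0 ≤ (1 - δ) / 2)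
  have B' := mul_le_mul_of_nonneg_left B (by positivity : 0 ≤ (1 - δ) / 2)
  refine C.trans ?_
  linarith

lemma one_var (Z : ℝ → ℝ) (hZ0 : ∀ t, 0 ≤ Z t)
    (hZ : ∀ t s μ, 0 < μ → μ < 1 → Z (t + μ * s) ≤ (1 - μ) * Z t + μ * Z (t + s))
    (t0 t : ℝ) (ht : |t - t0| < 1) :
    Z t ≤ (1 - |t - t0|) * Z t0 + |t - t0| * (Z (t0 + 1) + Z (t0 - 1)) ∧
    (1 + |t - t0|) * Z t0 - |t - t0| * (Z (t0 + 1) + Z (t0 - 1)) ≤ Z t := by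
  have low : ∀ e : ℝ, ∀ σ > 0, t = t0 + σ * e → (1 + σ) * Z t0 - σ * Z (t0 - e) ≤ Z t := by
    intro e σ hσ hte
    have h := hZ t (t0 - e - t) (σ / (1 + σ)) (by positivity) (by
      rw [div_lt_one (by positivity)]; linarith)
    have e1 : t + σ / (1 + σ) * (t0 - e - t) = t0 := by rw [hte]; field_simp; ring
    have e2 : t + (t0 - e - t) = t0 - e := by ring
    rw [e1, e2] at h
    have h' := mul_le_mul_of_nonneg_left h (by positivity : 0 ≤ 1 + σ)
    have e3 : (1 + σ) * ((1 - σ / (1 + σ)) * Z t + σ / (1 + σ) * Z (t0 - e)) =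
      Z t + σ * Z (t0 - e) := by field_simp; ring
    rw [e3] at h'
    linarith
  rcases lt_trichotomy t t0 with hlt | heq | hgt
  · have hs : |t - t0| = t0 - t := by rw [abs_of_neg (by linarith)]; ring
    rw [hs] at ht ⊢
    have up := hZ t0 (-1) (t0 - t) (by linarith) ht
    have lo := low (-1) (t0 - t) (by linarith) (by ring)
    rw [show t0 + (t0 - t) * -1 = t by ring, show t0 + -1 = t0 - 1 by ring] at up
    rw [sub_neg_eq_add] at lo
    have p1 := mul_nonneg (by linarith : 0 ≤ t0 - t) (hZ0 (t0 + 1))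
    have p2 := mul_nonneg (by linarith : 0 ≤ t0 - t) (hZ0 (t0 - 1))
    constructor <;> linarith
  · subst heq; simp
  · have hs : |t - t0| = t - t0 := abs_of_pos (by linarith)
    rw [hs] at ht ⊢
    have up := hZ t0 1 (t - t0) (by linarith) ht
    have lo := low 1 (t - t0) (by linarith) (by ring)
    rw [show t0 + (t - t0) * 1 = t by ring] at up
    have p1 := mul_nonneg (by linarith : 0 ≤ t - t0) (hZ0 (t0 + 1))
    have p2 := mul_nonneg (by linarith : 0 ≤ t - t0) (hZ0 (t0 - 1))
    constructor <;> linarith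

lemma sep_cont {ι : Type*} [Fintype ι] [DecidableEq ι] (G : (ι → ℝ) → ℝ) (hG0 : ∀ x, 0 ≤ G x)
    (hG : ∀ x j s μ, 0 < μ → μ < 1 →
      G (Function.update x j (x j + μ * s)) ≤ (1 - μ) * G x +
        μ * G (Function.update x j (x j + s))) : Continuous G := by
  have main : ∀ (S : Finset ι) (x0 : ι → ℝ), Continuous fun y => G (S.piecewise y x0) := by
    intro S
    induction S using Finset.induction_on with
    | empty => intro x0; simpa using continuous_const
    | insert j S hj ih =>
      intro x0
      have e : ∀ y : ι → ℝ, (insert j S).piecewise y x0 =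
          Function.update (S.piecewise y x0) j (y j) := fun y => by
        rw [Finset.piecewise_insert]
      have e2 : ∀ (y : ι → ℝ) (c : ℝ), Function.update (S.piecewise y x0) j c =
          S.piecewise y (Function.update x0 j c) := fun y c => by
        ext i
        by_cases hij : i = j
        · subst hij
          simp [Finset.piecewise, hj]
        · by_cases hi : i ∈ S <;> simp [Finset.piecewise, hi, hij]
      rw [continuous_iff_continuousAt]
      intro y0
      let A : ℝ → (ι → ℝ) → ℝ := fun c y => G (S.piecewise y (Function.update x0 j c))
      have hA : ∀ c, Continuous (A c) := fun c => ih _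
      have hbd : ∀ y : ι → ℝ, |y j - y0 j| < 1 →
          A (y j) y ≤ (1 - |y j - y0 j|) * A (y0 j) y +
            |y j - y0 j| * (A (y0 j + 1) y + A (y0 j - 1) y) ∧
          (1 + |y j - y0 j|) * A (y0 j) y -
            |y j - y0 j| * (A (y0 j + 1) y + A (y0 j - 1) y) ≤ A (y j) y := by
        intro y hy
        refine one_var (fun c => A c y) (fun _ => hG0 _) ?_ (y0 j) (y j) hy
        intro t s μ h0 h1
        have := hG (Function.update (S.piecewise y x0) j t) j s μ h0 h1
        simp only [Function.update_self, Function.update_idem] at this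
        simp only [e2] at this
        exact this
      have hfun : (fun y => G ((insert j S).piecewise y x0)) = fun y => A (y j) y := by
        funext y; rw [e, e2]
      rw [hfun]
      have hev : ∀ᶠ y : ι → ℝ in nhds y0, |y j - y0 j| < 1 := by
        have : ContinuousAt (fun y : ι → ℝ => |y j - y0 j|) y0 :=
          ((continuous_apply j).sub continuous_const).abs.continuousAt
        exact this.eventually_lt continuousAt_const (by simp)
      have c0 := hA (y0 j)
      have c1 := hA (y0 j + 1)
      have c2 := hA (y0 j - 1)
      have up : Continuous fun y : ι → ℝ => (1 - |y j - y0 j|) * A (y0 j) y +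
            |y j - y0 j| * (A (y0 j + 1) y + A (y0 j - 1) y) := by fun_prop
      have lo : Continuous fun y : ι → ℝ => (1 + |y j - y0 j|) * A (y0 j) y -
            |y j - y0 j| * (A (y0 j + 1) y + A (y0 j - 1) y) := by fun_prop
      have tu := up.tendsto y0
      have tl := lo.tendsto y0
      simp only [sub_self, abs_zero, sub_zero, one_mul, zero_mul, add_zero] at tu tl
      refine tendsto_of_tendsto_of_tendsto_of_le_of_le' tl tu ?_ ?_
      · filter_upwards [hev] with y hy using (hbd y hy).2
      · filter_upwards [hev] with y hy using (hbd y hy).1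
  simpa using main Finset.univ 0

section
variable {f : M32 → ℝ≥0∞} (hf : Continuous f) (hfin : ∀ ξ, qcEnv f ξ ≠ ⊤)

lemma qr_tri (hf : Continuous f) (hfin : ∀ ξ, qcEnv f ξ ≠ ⊤) (ξ : M32) (a : Fin 3 → ℝ)
    (g : Fin 3 → Fin 2 → ℝ) (w : Fin 3 → ℝ) (hw : ∀ i, 0 < w i)
    (hs : w 0 + w 1 + w 2 = 1) (hwg : ∀ j, w 0 * g 0 j + w 1 * g 1 j + w 2 * g 2 j = 0)
    (hD : g 0 0 * g 1 1 - g 0 1 * g 1 0 ≠ 0) :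
    (qcEnv f ξ).toReal ≤ w 0 * (qcEnv f (ξ + Matrix.vecMulVec a (g 0))).toReal +
      w 1 * (qcEnv f (ξ + Matrix.vecMulVec a (g 1))).toReal +
      w 2 * (qcEnv f (ξ + Matrix.vecMulVec a (g 2))).toReal := by
  refine le_of_forall_pos_le_add fun ε hε => ?_
  have h := qc_tri hf ξ a g w hw hs hwg hD
    (b := fun i => qcEnv f (ξ + Matrix.vecMulVec a (g i)) + ENNReal.ofReal ε)
    (fun i => ENNReal.lt_add_right (hfin _) (by simpa using hε))
  have hb : ∀ i, ENNReal.ofReal (w i) *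
      (qcEnv f (ξ + Matrix.vecMulVec a (g i)) + ENNReal.ofReal ε) ≠ ⊤ := fun i =>
    ENNReal.mul_ne_top ENNReal.ofReal_ne_top
      (ENNReal.add_ne_top.2 ⟨hfin _, ENNReal.ofReal_ne_top⟩)
  have h2 := ENNReal.toReal_mono (ENNReal.sum_ne_top.2 fun i _ => hb i) h
  rw [ENNReal.toReal_sum fun i _ => hb i, Fin.sum_univ_three] at h2
  simp only [ENNReal.toReal_mul, ENNReal.toReal_add (hfin _) ENNReal.ofReal_ne_top,
    ENNReal.toReal_ofReal hε.le, ENNReal.toReal_ofReal (hw _).le] at h2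
  have : ε = w 0 * ε + w 1 * ε + w 2 * ε := by linear_combination (-ε) * hs
  linarith

lemma qr_seg (hf : Continuous f) (hfin : ∀ ξ, qcEnv f ξ ≠ ⊤) (ξ : M32) (a : Fin 3 → ℝ)
    (d : Fin 2 → ℝ) (μ : ℝ) (h0 : 0 < μ) (h1 : μ < 1) :
    (qcEnv f (ξ + μ • Matrix.vecMulVec a d)).toReal ≤
      (1 - μ) * (qcEnv f ξ).toReal + μ * (qcEnv f (ξ + Matrix.vecMulVec a d)).toReal := by
  by_cases hd : d = 0
  · subst hd
    have hv : Matrix.vecMulVec a (0 : Fin 2 → ℝ) = 0 := by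
      ext k j; simp [Matrix.vecMulVec_apply]
    rw [hv, smul_zero, add_zero]
    apply le_of_eq; ring
  have hd2 : d 0 ^ 2 + d 1 ^ 2 ≠ 0 := by
    intro h
    apply hd
    ext j
    fin_cases j
    · simp; nlinarith [sq_nonneg (d 0), sq_nonneg (d 1)]
    · simp; nlinarith [sq_nonneg (d 0), sq_nonneg (d 1)]
  have key := seg_of_tri (fun s t => (qcEnv f (ξ + Matrix.vecMulVec a
    ![s * d 0 - t * d 1, s * d 1 + t * d 0])).toReal) (by
      intro w0 w1 w2 s0 t0 s1 t1 s2 t2 s t hw0 hw1 hw2 hs hS hT hD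
      have h := qr_tri hf hfin (ξ + Matrix.vecMulVec a ![s * d 0 - t * d 1, s * d 1 + t * d 0]) a
        ![![(s0 - s) * d 0 - (t0 - t) * d 1, (s0 - s) * d 1 + (t0 - t) * d 0],
          ![(s1 - s) * d 0 - (t1 - t) * d 1, (s1 - s) * d 1 + (t1 - t) * d 0],
          ![(s2 - s) * d 0 - (t2 - t) * d 1, (s2 - s) * d 1 + (t2 - t) * d 0]] ![w0, w1, w2]
        (fun i => by fin_cases i <;> simpa) (by simpa using hs)
        (fun j => by
          fin_cases j
          · simp
            linear_combination (s * d 0 * (-1) + t * d 1) * hs - d 0 * hS + d 1 * hT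
          · simp
            linear_combination (s * d 1 * (-1) - t * d 0) * hs - d 1 * hS - d 0 * hT)
        (by
          simp
          intro h
          apply mul_ne_zero hD hd2
          linear_combination h)
      have e : ∀ s' t', ξ + Matrix.vecMulVec a ![s * d 0 - t * d 1, s * d 1 + t * d 0] +
          Matrix.vecMulVec a ![(s' - s) * d 0 - (t' - t) * d 1, (s' - s) * d 1 + (t' - t) * d 0] =
          ξ + Matrix.vecMulVec a ![s' * d 0 - t' * d 1, s' * d 1 + t' * d 0] := by
        intro s' t'
        ext k j
        fin_cases j <;> simp [Matrix.vecMulVec_apply] <;> ring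
      show (qcEnv f _).toReal ≤ w0 * (qcEnv f _).toReal + w1 * (qcEnv f _).toReal +
        w2 * (qcEnv f _).toReal
      rw [← e s0 t0, ← e s1 t1, ← e s2 t2]
      exact h) μ h0 h1
  have e1 : Matrix.vecMulVec a ![μ * d 0 - 0 * d 1, μ * d 1 + 0 * d 0] =
      μ • Matrix.vecMulVec a d := by
    ext k j; fin_cases j <;> simp [Matrix.vecMulVec_apply] <;> ring
  have e2 : Matrix.vecMulVec a ![(0:ℝ) * d 0 - 0 * d 1, 0 * d 1 + 0 * d 0] = 0 := by
    ext k j; fin_cases j <;> simp [Matrix.vecMulVec_apply]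
  have e3 : Matrix.vecMulVec a ![1 * d 0 - 0 * d 1, 1 * d 1 + 0 * d 0] =
      Matrix.vecMulVec a d := by
    ext k j; fin_cases j <;> simp [Matrix.vecMulVec_apply]
  simpa only [e1, e2, e3, add_zero] using key

lemma qc_cont (hf : Continuous f) (hfin : ∀ ξ, qcEnv f ξ ≠ ⊤) : Continuous (qcEnv f) := by
  have h1 := sep_cont (ι := Fin 3 × Fin 2)
    (fun y => (qcEnv f (Matrix.of fun i j => y (i, j))).toReal) (fun _ => ENNReal.toReal_nonneg) (by
      rintro x ⟨i, j⟩ s μ h0 h1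
      have h := qr_seg hf hfin (Matrix.of fun i j => x (i, j)) (Pi.single i 1) (Pi.single j s) μ h0 h1
      have e : ∀ r, (Matrix.of fun i' j' => Function.update x (i, j) (x (i, j) + r) (i', j') : M32) =
          Matrix.of (fun i j => x (i, j)) + Matrix.vecMulVec (Pi.single i 1) (Pi.single j r) := by
        intro r
        ext i' j'
        simp only [Function.update_apply, Prod.mk.injEq, Matrix.of_apply, Matrix.add_apply,
          Matrix.vecMulVec_apply, Pi.single_apply]
        by_cases hi : i' = i <;> by_cases hj : j' = j <;> simp [hi, hj]
      have e' : Matrix.vecMulVec (Pi.single i 1 : Fin 3 → ℝ) (Pi.single j (μ * s) : Fin 2 → ℝ) =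
          μ • Matrix.vecMulVec (Pi.single i 1) (Pi.single j s) := by
        ext i' j'
        simp only [Matrix.vecMulVec_apply, Pi.single_apply, Matrix.smul_apply, smul_eq_mul]
        by_cases hi : i' = i <;> by_cases hj : j' = j <;> simp [hi, hj]
      simp only [e, e']
      exact h)
  have h3 : Continuous fun (A : M32) (q : Fin 3 × Fin 2) => A q.1 q.2 :=
    continuous_pi fun q => (continuous_apply q.2).comp (continuous_apply q.1)
  have h4 := ENNReal.continuous_ofReal.comp (h1.comp h3)
  refine h4.congr fun A => ?_
  exact ENNReal.ofReal_toReal (hfin A)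

lemma qc_rank (hf : Continuous f) (hfin : ∀ ξ, qcEnv f ξ ≠ ⊤) : RankOneConvexENN (qcEnv f) := by
  intro ξ ξ' lam hl hr
  obtain ⟨a, d, had⟩ : ∃ (a : Fin 3 → ℝ) (d : Fin 2 → ℝ), ξ - ξ' = Matrix.vecMulVec a d := by
    rw [Matrix.rank_eq_finrank_span_cols] at hr
    obtain ⟨v, -, hv⟩ := finrank_eq_one_iff'.1 hr
    have : ∀ j, ∃ c : ℝ, c • (v : Fin 3 → ℝ) = (ξ - ξ').col j := fun j => by
      obtain ⟨c, hc⟩ := hv ⟨(ξ - ξ').col j, Submodule.subset_span ⟨j, rfl⟩⟩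
      exact ⟨c, congrArg Subtype.val hc⟩
    choose d hd using this
    refine ⟨v, d, ?_⟩
    ext i j
    have := congrFun (hd j) i
    rw [Matrix.vecMulVec_apply, mul_comm]
    exact this.symm
  have h := qr_seg hf hfin ξ' a d lam hl.1 hl.2
  rw [← had] at h
  have e1 : ξ' + lam • (ξ - ξ') = lam • ξ + (1 - lam) • ξ' := by
    rw [smul_sub, sub_smul, one_smul]; abel
  rw [e1, add_sub_cancel] at h
  rw [← ENNReal.ofReal_toReal (hfin (lam • ξ + (1 - lam) • ξ')),
    ← ENNReal.ofReal_toReal (hfin ξ), ← ENNReal.ofReal_toReal (hfin ξ'),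
    ← ENNReal.ofReal_mul hl.1.le, ← ENNReal.ofReal_mul (by linarith [hl.2]),
    ← ENNReal.ofReal_add (mul_nonneg hl.1.le ENNReal.toReal_nonneg)
      (mul_nonneg (by linarith [hl.2]) ENNReal.toReal_nonneg)]
  apply ENNReal.ofReal_le_ofReal
  linarith
end

lemma mnorm_lower (ξ J : M32) {p : ℝ} (hp : 1 < p) (hs : 0 < mnorm ξ) :
    mnorm ξ ^ p * (1 + p * ((∑ i, ∑ j, ξ i j * J i j) / mnorm ξ ^ 2)) ≤ mnorm (ξ + J) ^ p := by
  set s := mnorm ξ with hsd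
  set u := (∑ i, ∑ j, ξ i j * J i j) / s ^ 2 with hu
  have hn : 0 ≤ mnorm (ξ + J) := Real.sqrt_nonneg _
  have hss : s ^ 2 = ∑ i, ∑ j, ξ i j ^ 2 := Real.sq_sqrt (by positivity)
  have hCS : s ^ 2 * (1 + u) ≤ s * mnorm (ξ + J) := by
    have h1 : s ^ 2 * (1 + u) = ∑ i, ∑ j, ξ i j * (ξ + J) i j := by
      have : s ^ 2 * (1 + u) = s ^ 2 + ∑ i, ∑ j, ξ i j * J i j := by rw [hu]; field_simp
      rw [this, hss, ← Finset.sum_add_distrib]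
      refine Finset.sum_congr rfl fun i _ => ?_
      rw [← Finset.sum_add_distrib]
      refine Finset.sum_congr rfl fun j _ => ?_
      rw [Matrix.add_apply]; ring
    rw [h1, hsd]
    unfold mnorm
    rw [← Fintype.sum_prod_type', ← Fintype.sum_prod_type', ← Fintype.sum_prod_type']
    exact Real.sum_mul_le_sqrt_mul_sqrt _ _ _
  have hle : s * (1 + u) ≤ mnorm (ξ + J) := by
    refine le_of_mul_le_mul_left ?_ hs
    calc s * (s * (1 + u)) = s ^ 2 * (1 + u) := by ring
      _ ≤ _ := hCS
  by_cases hu1 : -1 ≤ u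
  · calc s ^ p * (1 + p * u) ≤ s ^ p * (1 + u) ^ p := by
          gcongr; exact one_add_mul_self_le_rpow_one_add hu1 hp.le
      _ = (s * (1 + u)) ^ p := (Real.mul_rpow hs.le (by linarith)).symm
      _ ≤ _ := Real.rpow_le_rpow (mul_nonneg hs.le (by linarith)) hle (by linarith)
  · push Not at hu1
    have h1 : 1 + p * u ≤ 0 := by nlinarith
    exact (mul_nonpos_of_nonneg_of_nonpos (by positivity) h1).trans (by positivity)

lemma ofReal_int_le {μ : Measure E2} {h : E2 → ℝ} (hi : Integrable h μ) :
    ENNReal.ofReal (∫ x, h x ∂μ) ≤ ∫⁻ x, ENNReal.ofReal (h x) ∂μ := by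
  have h1 : ∫ x, h x ∂μ ≤ ∫ x, max (h x) 0 ∂μ :=
    integral_mono hi hi.pos_part fun x => le_max_left _ _
  refine (ENNReal.ofReal_le_ofReal h1).trans_eq ?_
  rw [ofReal_integral_eq_lintegral_ofReal hi.pos_part (Filter.Eventually.of_forall fun x =>
    le_max_right _ _)]
  refine lintegral_congr fun x => ?_
  rw [ENNReal.ofReal_max]; simp

lemma qc_coer {p C₁ : ℝ} (hp : 1 < p) (hC₁ : 0 < C₁) {f : M32 → ℝ≥0∞}
    (hco : ∀ A, ENNReal.ofReal (C₁ * mnorm A ^ p - 1 / C₁) ≤ f A) (ξ : M32) :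
    ENNReal.ofReal (C₁ * mnorm ξ ^ p - 1 / C₁) ≤ qcEnv f ξ := by
  have hnn : 0 ≤ mnorm ξ := Real.sqrt_nonneg _
  rcases hnn.eq_or_lt with hs | hs
  · rw [← hs, Real.zero_rpow (by linarith), ENNReal.ofReal_of_nonpos]
    · exact zero_le
    · have : 0 < 1 / C₁ := by positivity
      linarith
  refine le_of_forall_gt fun c hc => ?_
  by_contra hcon
  push Not at hcon
  obtain ⟨c', hc1, hc2⟩ := exists_between (lt_of_lt_of_le hc le_rfl)
  obtain ⟨φ, L, hL, h0, hi⟩ := qc_exists f ξ hc1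
  have hJ := fun i j => jac_mean (convex_ball _ _) (Metric.isOpen_ball : IsOpen BB)
    Metric.isBounded_ball hL h0 i j
  let T : E2 → ℝ := fun x => ∑ i, ∑ j, ξ i j * jacMat φ x i j
  have hI : ∀ (i : Fin 3) (j : Fin 2), Integrable (fun x => ξ i j * jacMat φ x i j)
      (volume.restrict BB) := fun i j => (hJ i j).1.const_mul _
  have hTi : Integrable T (volume.restrict BB) :=
    integrable_finsetSum _ fun i _ => integrable_finsetSum _ fun j _ => (hJ i j).1.const_mul _
  have hT0 : ∫ x in BB, T x = 0 := by
    show ∫ x in BB, ∑ i, ∑ j, ξ i j * jacMat φ x i j = 0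
    have hS : ∀ i : Fin 3, Integrable (fun x => ∑ j, ξ i j * jacMat φ x i j)
      (volume.restrict BB) := fun i => integrable_finsetSum _ fun j _ => hI i j
    rw [integral_finsetSum _ fun i _ => hS i]
    refine Finset.sum_eq_zero fun i _ => ?_
    rw [integral_finsetSum _ fun j _ => hI i j]
    refine Finset.sum_eq_zero fun j _ => ?_
    rw [integral_const_mul, (hJ i j).2, mul_zero]
  let c0 := C₁ * mnorm ξ ^ p - 1 / C₁
  let c1 := C₁ * mnorm ξ ^ p * p / mnorm ξ ^ 2
  have hcc : IntegrableOn (fun _ : E2 => c0) BB := integrableOn_const BB_fin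
  have hint : ∫ x in BB, (c0 + c1 * T x) = c0 * (volume BB).toReal := by
    rw [integral_add hcc (hTi.const_mul _), integral_const_mul, hT0]
    simp [Measure.real, mul_comm]
  have hle := ofReal_int_le (hcc.add (hTi.const_mul c1))
  simp only [Pi.add_apply] at hle
  rw [hint, ENNReal.ofReal_mul' ENNReal.toReal_nonneg, ENNReal.ofReal_toReal BB_fin] at hle
  have hpt : ∀ x, ENNReal.ofReal (c0 + c1 * T x) ≤ f (ξ + jacMat φ x) := by
    intro x
    refine le_trans (ENNReal.ofReal_le_ofReal ?_) (hco _)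
    have := mul_le_mul_of_nonneg_left (mnorm_lower ξ (jacMat φ x) hp hs) hC₁.le
    have e : C₁ * (mnorm ξ ^ p * (1 + p * ((∑ i, ∑ j, ξ i j * jacMat φ x i j) / mnorm ξ ^ 2))) =
      c0 + c1 * T x + 1 / C₁ := by simp only [c0, c1, T]; ring
    rw [e] at this
    linarith
  have h3 := hle.trans ((lintegral_mono hpt).trans hi)
  have h4 := (ENNReal.mul_le_mul_iff_left BB_pos BB_fin).1 h3
  exact absurd (h4.trans_lt hc2) (not_lt.2 hcon)

/-- the quasiconvex envelope QW₀ is finite valued, continuous, p-coercive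
and rank-one convex. -/
theorem stmt13
    (p C₁ : ℝ) (hp : 1 < p) (hC₁ : 0 < C₁)
    (W₀ : Matrix (Fin 3) (Fin 2) ℝ → ℝ≥0∞)
    -- W₀ continuous as an extended-valued function
    (hW₀cont : Continuous W₀)
    -- W₀ p-coercive
    (hW₀coer : ∀ A, ENNReal.ofReal (C₁ * mnorm A ^ p - 1 / C₁) ≤ W₀ A)
    -- W₀(A) = +∞ iff A¹ ∧ A² = 0
    (hW₀top : ∀ A, W₀ A = ⊤ ↔ crossCols A = 0)
    -- p-growth where |A¹ ∧ A²| is bounded away from 0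
    (hW₀grow : ∀ δ : ℝ, 0 < δ → ∃ c : ℝ, 0 < c ∧ ∀ A, δ ≤ vnorm (crossCols A) →
      W₀ A ≤ ENNReal.ofReal (c * (1 + mnorm A ^ p)))
    :
    (∀ A, qcEnv W₀ A ≠ ⊤) ∧
    Continuous (qcEnv W₀) ∧
    (∃ C : ℝ, 0 < C ∧ ∀ A, ENNReal.ofReal (C * mnorm A ^ p - 1 / C) ≤ qcEnv W₀ A) ∧
    RankOneConvexENN (qcEnv W₀) := by
  have hfin : ∀ A, qcEnv W₀ A ≠ ⊤ :=
    qc_fin hW₀cont (fun A hA h => hA ((hW₀top A).1 h))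
  exact ⟨hfin, qc_cont hW₀cont hfin, ⟨C₁, hC₁, qc_coer hp hC₁ hW₀coer⟩, qc_rank hW₀cont hfin⟩
end
end

section
/- Let 1 < p < ∞ and let W₀ : M^{3×2} → [0,+∞] be continuous as an extended-valued function and p-coercive, with W₀(A) = +∞ if and only if A¹ ∧ A² = 0, and such that for every δ > 0 there exists c_δ > 0 with W₀(A) ≤ c_δ(1 + |A|^p) whenever |A¹ ∧ A²| ≥ δ. Define R₀W₀ := W₀ and, for i ≥ 0 and A ∈ M^{3×2}, R_{i+1}W₀(A) := inf{ (1−λ) R_iW₀(A − λ b⊗a) + λ R_iW₀(A + (1−λ) b⊗a) : a ∈ ℝ², b ∈ ℝ³, λ ∈ [0,1] }. Then: R_iW₀ is upper semicontinuous for every i ≥ 0; R_iW₀ is finite valued for every i ≥ 2; R_{i+1}W₀ ≤ R_iW₀ for every i ≥ 0; and the rank-one convex envelope satisfies RW₀(A) = inf_{i ≥ 0} R_iW₀(A) for every A ∈ M^{3×2}. -/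
open Filter MeasureTheory Set
open scoped ENNReal

noncomputable section

/-- The Kohn–Strang iterative scheme for the rank-one convex envelope. -/
noncomputable def RIter (f : Matrix (Fin 3) (Fin 2) ℝ → ℝ≥0∞) :
    ℕ → Matrix (Fin 3) (Fin 2) ℝ → ℝ≥0∞
  | 0 => f
  | (i+1) => fun A =>
      ⨅ (a : Fin 2 → ℝ) (b : Fin 3 → ℝ) (lam : ℝ) (_ : lam ∈ Set.Icc (0:ℝ) 1),
        ENNReal.ofReal (1 - lam) * RIter f i (A - lam • Matrix.vecMulVec b a) +
        ENNReal.ofReal lam * RIter f i (A + (1 - lam) • Matrix.vecMulVec b a)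

theorem RIter_succ_le (f : M32 → ℝ≥0∞) (i : ℕ) (A : M32) (a : Fin 2 → ℝ) (b : Fin 3 → ℝ)
    (lam : ℝ) (h : lam ∈ Set.Icc (0:ℝ) 1) :
    RIter f (i+1) A ≤ ENNReal.ofReal (1 - lam) * RIter f i (A - lam • Matrix.vecMulVec b a) +
        ENNReal.ofReal lam * RIter f i (A + (1 - lam) • Matrix.vecMulVec b a) :=
  iInf_le_of_le a (iInf_le_of_le b (iInf_le_of_le lam (iInf_le_of_le h le_rfl)))

theorem RIter_anti (f : M32 → ℝ≥0∞) (i : ℕ) (A : M32) : RIter f (i+1) A ≤ RIter f i A := by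
  have := RIter_succ_le f i A 0 0 0 (by simp)
  simpa using this

theorem RIter_usc (f : M32 → ℝ≥0∞) (hf : Continuous f) (i : ℕ) :
    UpperSemicontinuous (RIter f i) := by
  induction i with
  | zero => exact hf.upperSemicontinuous
  | succ i ih =>
    unfold RIter
    refine upperSemicontinuous_iInf fun a => upperSemicontinuous_iInf fun b =>
      upperSemicontinuous_iInf fun lam => upperSemicontinuous_iInf fun h => ?_
    refine UpperSemicontinuous.add ?_ ?_
    · exact (ENNReal.continuous_const_mul (a := ENNReal.ofReal (1 - lam))
        ENNReal.ofReal_ne_top).comp_upperSemicontinuous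
        (ih.comp (g := fun A : M32 => A - lam • Matrix.vecMulVec b a) (by fun_prop))
        (fun x y hxy => by dsimp only; gcongr)
    · exact (ENNReal.continuous_const_mul (a := ENNReal.ofReal lam)
        ENNReal.ofReal_ne_top).comp_upperSemicontinuous
        (ih.comp (g := fun A : M32 => A + (1 - lam) • Matrix.vecMulVec b a) (by fun_prop))
        (fun x y hxy => by dsimp only; gcongr)

theorem exists_dir (A : M32) (hA : A ≠ 0) (hc : crossCols A = 0) :
    ∃ (a : Fin 2 → ℝ) (b : Fin 3 → ℝ), ∀ t : ℝ, t ≠ 0 →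
      crossCols (A + t • Matrix.vecMulVec b a) ≠ 0 := by
  obtain ⟨k, j, hkj⟩ : ∃ k j, A k j ≠ 0 := by
    by_contra! h
    exact hA (by ext k j; simpa using h k j)
  refine ⟨Pi.single (j + 1) 1, Pi.single (k + 1) 1, fun t ht h => ?_⟩
  have e0 := congrFun hc 0
  have e1 := congrFun hc 1
  have e2 := congrFun hc 2
  have f0 := congrFun h 0
  have f1 := congrFun h 1
  have f2 := congrFun h 2
  suffices t * A k j = 0 by
    rcases mul_eq_zero.1 this with h | h
    · exact ht h
    · exact hkj h
  clear h hc hkj hA ht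
  fin_cases k <;> fin_cases j <;>
    simp [-mul_eq_zero, crossCols, cross3, Matrix.vecMulVec_apply] at * <;> linarith

theorem RIter_one_fin (f : M32 → ℝ≥0∞) (hf : ∀ A, f A = ⊤ ↔ crossCols A = 0) (A : M32)
    (hA : A ≠ 0) : RIter f 1 A ≠ ⊤ := by
  by_cases hc : crossCols A = 0
  · obtain ⟨a, b, hab⟩ := exists_dir A hA hc
    refine ne_top_of_le_ne_top ?_ (RIter_succ_le f 0 A a b (1/2) (by norm_num))
    have h1 : f (A - (1/2:ℝ) • Matrix.vecMulVec b a) ≠ ⊤ := by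
      rw [Ne, hf, sub_eq_add_neg, ← neg_smul]
      exact hab _ (by norm_num)
    have h2 : f (A + (1 - 1/2:ℝ) • Matrix.vecMulVec b a) ≠ ⊤ := by
      rw [Ne, hf]
      exact hab _ (by norm_num)
    exact ENNReal.add_ne_top.2 ⟨ENNReal.mul_ne_top ENNReal.ofReal_ne_top h1,
      ENNReal.mul_ne_top ENNReal.ofReal_ne_top h2⟩
  · exact ne_top_of_le_ne_top (fun h => hc ((hf A).1 h)) (RIter_anti f 0 A)

theorem RIter_two_fin (f : M32 → ℝ≥0∞) (hf : ∀ A, f A = ⊤ ↔ crossCols A = 0) (A : M32) :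
    RIter f 2 A ≠ ⊤ := by
  by_cases hA : A = 0
  · subst hA
    have hne : ∀ t : ℝ, t ≠ 0 → t • Matrix.vecMulVec (fun _ : Fin 3 => (1:ℝ)) (fun _ : Fin 2 => (1:ℝ)) ≠ 0 := by
      intro t ht h
      have := congrFun (congrFun h 0) 0
      simp [Matrix.vecMulVec_apply] at this
      exact ht this
    refine ne_top_of_le_ne_top ?_ (RIter_succ_le f 1 0 (fun _ => 1) (fun _ => 1) (1/2) (by norm_num))
    refine ENNReal.add_ne_top.2 ⟨ENNReal.mul_ne_top ENNReal.ofReal_ne_top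
      (RIter_one_fin f hf _ ?_), ENNReal.mul_ne_top ENNReal.ofReal_ne_top
      (RIter_one_fin f hf _ ?_)⟩
    · rw [zero_sub, ← neg_smul]
      exact hne _ (by norm_num)
    · rw [zero_add]
      exact hne _ (by norm_num)
  · exact ne_top_of_le_ne_top (RIter_one_fin f hf A hA) (RIter_anti f 1 A)

theorem rank_one_exists (M : M32) (h : M.rank = 1) : ∃ a b, M = Matrix.vecMulVec b a := by
  unfold Matrix.rank at h
  obtain ⟨v, -, hv⟩ := finrank_eq_one_iff'.1 h
  choose c hc using fun j : Fin 2 => hv ⟨M.mulVecLin (Pi.single j 1), LinearMap.mem_range_self _ _⟩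
  refine ⟨c, v.1, ?_⟩
  ext i j
  have := congrFun (congrArg Subtype.val (hc j)) i
  simp [Matrix.col_apply] at this
  rw [Matrix.vecMulVec_apply, ← this, mul_comm]

theorem rank_vmv (b : Fin 3 → ℝ) (a : Fin 2 → ℝ) (h : Matrix.vecMulVec b a ≠ 0) :
    (Matrix.vecMulVec b a).rank = 1 := by
  refine le_antisymm (Matrix.rank_vecMulVec_le b a) (Nat.one_le_iff_ne_zero.2 fun h0 => h ?_)
  unfold Matrix.rank at h0
  rw [Submodule.finrank_eq_zero, LinearMap.range_eq_bot] at h0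
  ext i j
  have := congrFun (LinearMap.congr_fun h0 (Pi.single j 1)) i
  simpa [Matrix.col_apply] using this

theorem le_RIter (f g : M32 → ℝ≥0∞) (hg : RankOneConvexENN g) (hgf : ∀ B, g B ≤ f B) (i : ℕ) :
    ∀ A, g A ≤ RIter f i A := by
  induction i with
  | zero => exact hgf
  | succ i ih =>
    intro A
    refine le_iInf fun a => le_iInf fun b => le_iInf fun lam => le_iInf fun h => ?_
    refine le_trans ?_ (add_le_add (mul_le_mul_right (ih _) _) (mul_le_mul_right (ih _) _))
    rcases eq_or_lt_of_le h.1 with h0 | h0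
    · subst h0; simp
    rcases eq_or_lt_of_le h.2 with h1 | h1
    · subst h1; simp
    by_cases hz : Matrix.vecMulVec b a = 0
    · rw [hz]
      simp only [smul_zero, sub_zero, add_zero, ← add_mul]
      rw [← ENNReal.ofReal_add (by linarith) h.1]
      simp
    · have := hg (A + (1 - lam) • Matrix.vecMulVec b a) (A - lam • Matrix.vecMulVec b a) lam
        ⟨h0, h1⟩ (by
          have : A + (1 - lam) • Matrix.vecMulVec b a - (A - lam • Matrix.vecMulVec b a)
            = Matrix.vecMulVec b a := by module
          rw [this]; exact rank_vmv b a hz)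
      have e : lam • (A + (1 - lam) • Matrix.vecMulVec b a) +
        (1 - lam) • (A - lam • Matrix.vecMulVec b a) = A := by module
      rw [e, add_comm] at this
      exact this

theorem iInf_roc (f : M32 → ℝ≥0∞) : RankOneConvexENN (fun A => ⨅ i : ℕ, RIter f i A) := by
  intro ξ ξ' lam h hr
  obtain ⟨a, b, hab⟩ := rank_one_exists _ hr
  have anti : ∀ A, Antitone (fun i => RIter f i A) := fun A =>
    antitone_nat_of_succ_le fun i => RIter_anti f i A
  dsimp only
  rw [ENNReal.mul_iInf (by simp), ENNReal.mul_iInf (by simp), ENNReal.iInf_add_iInf]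
  · refine le_iInf fun i => iInf_le_of_le (i+1) ?_
    refine (RIter_succ_le f i _ a b lam ⟨h.1.le, h.2.le⟩).trans ?_
    rw [← hab, add_comm]
    have e1 : lam • ξ + (1 - lam) • ξ' - lam • (ξ - ξ') = ξ' := by module
    have e2 : lam • ξ + (1 - lam) • ξ' + (1 - lam) • (ξ - ξ') = ξ := by module
    rw [e1, e2]
  · intro i j
    refine ⟨max i j, ?_⟩
    exact add_le_add (mul_le_mul_right (anti _ (le_max_left _ _)) _)
      (mul_le_mul_right (anti _ (le_max_right _ _)) _)

/-- properties of the Kohn–Strang iterates R_iW₀ and identification of the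
rank-one convex envelope as their pointwise infimum. -/
theorem stmt14
    (p C₁ : ℝ) (hp : 1 < p) (hC₁ : 0 < C₁)
    (W₀ : Matrix (Fin 3) (Fin 2) ℝ → ℝ≥0∞)
    -- W₀ continuous as an extended-valued function
    (hW₀cont : Continuous W₀)
    -- W₀ p-coercive
    (hW₀coer : ∀ A, ENNReal.ofReal (C₁ * mnorm A ^ p - 1 / C₁) ≤ W₀ A)
    -- W₀(A) = +∞ iff A¹ ∧ A² = 0
    (hW₀top : ∀ A, W₀ A = ⊤ ↔ crossCols A = 0)
    -- p-growth where |A¹ ∧ A²| is bounded away from 0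
    (hW₀grow : ∀ δ : ℝ, 0 < δ → ∃ c : ℝ, 0 < c ∧ ∀ A, δ ≤ vnorm (crossCols A) →
      W₀ A ≤ ENNReal.ofReal (c * (1 + mnorm A ^ p)))
    :
    (∀ i : ℕ, UpperSemicontinuous (RIter W₀ i)) ∧
    (∀ i : ℕ, 2 ≤ i → ∀ A, RIter W₀ i A ≠ ⊤) ∧
    (∀ (i : ℕ) (A), RIter W₀ (i+1) A ≤ RIter W₀ i A) ∧
    (∀ A, rankOneEnv W₀ A = ⨅ i : ℕ, RIter W₀ i A) := by
  refine ⟨RIter_usc W₀ hW₀cont, ?_, RIter_anti W₀, ?_⟩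
  · intro i hi A
    have anti : Antitone (fun i => RIter W₀ i A) :=
      antitone_nat_of_succ_le fun i => RIter_anti W₀ i A
    exact ne_top_of_le_ne_top (RIter_two_fin W₀ hW₀top A) (anti hi)
  · intro A
    refine le_antisymm ?_ ?_
    · exact iSup₂_le fun g hg => le_iInf fun i => le_RIter W₀ g hg.1 hg.2 i A
    · exact le_iSup₂_of_le (fun A => ⨅ i : ℕ, RIter W₀ i A)
        ⟨iInf_roc W₀, fun B => iInf_le_of_le 0 le_rfl⟩ le_rfl
end
end
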